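/- arXiv:2005.00765 — 5 statements merged into one kernel-verified Lean document; each statement's English description precedes it below -/
import Mathlib

section
/- Fix ω₀ ≥ 0, ω₁ > 0 and set ω(λ) = √(ω₀² + 2ω₁²(1 − cos λ)). Let Q, P : ℝ → ℂ be continuous 2π-periodic functions, and for k ∈ ℤ, t ∈ ℝ define q_k(t) = (1/2π)·∫₀^{2π} ( Q(λ)·cos(t·ω(λ)) + P(λ)·sin(t·ω(λ))/ω(λ) )·e^{−ikλ} dλ, where sin(t·ω(λ))/ω(λ) is interpreted as t at points where ω(λ) = 0. Then for every k the function t ↦ q_k(t) is twice continuously differentiable, q_k(0) = (1/2π)∫₀^{2π} Q(λ)e^{−ikλ} dλ, q_k'(0) = (1/2π)∫₀^{2π} P(λ)e^{−ikλ} dλ, and for all t: q_k''(t) = −ω₀² q_k(t) + ω₁²(q_{k+1}(t) − 2q_k(t) + q_{k−1}(t)). -/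
open scoped Real
open MeasureTheory Complex

/-- Differentiation under the integral sign for jointly continuous integrands. -/
theorem hasDerivAt_intervalIntegral_of_continuous {F F' : ℝ → ℝ → ℂ} (a b : ℝ)
    (hF : Continuous (Function.uncurry F)) (hF' : Continuous (Function.uncurry F'))
    (hderiv : ∀ t l, HasDerivAt (fun s => F s l) (F' t l) t) (t : ℝ) :
    HasDerivAt (fun s => ∫ l in a..b, F s l) (∫ l in a..b, F' t l) t := by
  have hc : ∀ {G : ℝ → ℝ → ℂ}, Continuous (Function.uncurry G) → ∀ s, Continuous (G s) :=
    fun hG s => hG.comp (Continuous.prodMk_right s)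
  obtain ⟨C, hC⟩ := ((isCompact_closedBall t 1).prod (isCompact_uIcc (a := a) (b := b))
    ).exists_bound_of_continuousOn hF'.continuousOn
  refine (intervalIntegral.hasDerivAt_integral_of_dominated_loc_of_deriv_le
    (bound := fun _ => C) (Metric.closedBall_mem_nhds t one_pos)
    (.of_forall fun s => (hc hF s).aestronglyMeasurable) ((hc hF t).intervalIntegrable _ _)
    (hc hF' t).aestronglyMeasurable ?_ intervalIntegrable_const ?_).2
  · exact .of_forall fun l hl s hs => hC (s, l) ⟨hs, Set.uIoc_subset_uIcc hl⟩
  · exact .of_forall fun l _ s _ => hderiv s l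

theorem mul_sinc_mul (t w : ℝ) :
    t * Real.sinc (t * w) = if w = 0 then t else Real.sin (t * w) / w := by
  split_ifs with hw
  · simp [hw]
  · rcases eq_or_ne t 0 with rfl | ht
    · simp
    · rw [Real.sinc_of_ne_zero (mul_ne_zero ht hw)]
      field_simp

theorem hasDerivAt_cos_mul_const (w t : ℝ) :
    HasDerivAt (fun s => Real.cos (s * w)) (-(w * Real.sin (t * w))) t := by
  exact (hasDerivAt_mul_const w).cos.congr_deriv (by ring)

theorem hasDerivAt_mul_sinc_mul (w t : ℝ) :
    HasDerivAt (fun s => s * Real.sinc (s * w)) (Real.cos (t * w)) t := by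
  simp_rw [mul_sinc_mul]
  split_ifs with hw
  · simpa [hw] using hasDerivAt_id' t
  · exact ((hasDerivAt_mul_const w).sin.div_const w).congr_deriv (mul_div_cancel_right₀ _ hw)

theorem exp_succ_add_exp_pred (k : ℤ) (l : ℝ) :
    Complex.exp (-Complex.I * ((k + 1 : ℤ) : ℂ) * l) +
        Complex.exp (-Complex.I * ((k - 1 : ℤ) : ℂ) * l) =
      2 * (Real.cos l : ℂ) * Complex.exp (-Complex.I * (k : ℂ) * l) := by
  rw [Complex.ofReal_cos, Complex.two_cos, add_mul, ← Complex.exp_add, ← Complex.exp_add,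
    add_comm]
  push_cast
  congr 2 <;> ring

/-- The Fourier-integral formula yields a `C²` solution of the infinite
harmonic chain with the prescribed initial positions and velocities. -/
theorem harmonic_chain_fourier_solution (ω₀ ω₁ : ℝ) (hω₀ : 0 ≤ ω₀) (hω₁ : 0 < ω₁)
    (ω : ℝ → ℝ) (hω : ∀ l : ℝ, ω l = Real.sqrt (ω₀ ^ 2 + 2 * ω₁ ^ 2 * (1 - Real.cos l)))
    (Q P : ℝ → ℂ) (hQc : Continuous Q) (hPc : Continuous P)
    (hQper : Function.Periodic Q (2 * π)) (hPper : Function.Periodic P (2 * π))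
    (q : ℤ → ℝ → ℂ)
    (hq : ∀ (k : ℤ) (t : ℝ), q k t =
      (1 / (2 * (π : ℂ))) * ∫ l in (0:ℝ)..(2 * π),
        (Q l * (Real.cos (t * ω l) : ℂ) +
            P l * (if ω l = 0 then (t : ℂ) else ((Real.sin (t * ω l) / ω l : ℝ) : ℂ))) *
          Complex.exp (-Complex.I * (k : ℂ) * (l : ℂ))) :
    ∀ k : ℤ,
      ContDiff ℝ 2 (q k) ∧
      q k 0 = (1 / (2 * (π : ℂ))) *
        ∫ l in (0:ℝ)..(2 * π), Q l * Complex.exp (-Complex.I * (k : ℂ) * (l : ℂ)) ∧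
      deriv (q k) 0 = (1 / (2 * (π : ℂ))) *
        ∫ l in (0:ℝ)..(2 * π), P l * Complex.exp (-Complex.I * (k : ℂ) * (l : ℂ)) ∧
      ∀ t : ℝ, deriv (deriv (q k)) t =
        -(ω₀ : ℂ) ^ 2 * q k t + (ω₁ : ℂ) ^ 2 * (q (k + 1) t - 2 * q k t + q (k - 1) t) := by
  have hωc : Continuous ω := by
    rw [funext hω]
    fun_prop
  have hωsq : ∀ l, ω l ^ 2 = ω₀ ^ 2 + 2 * ω₁ ^ 2 * (1 - Real.cos l) := fun l => by
    rw [hω, Real.sq_sqrt]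
    have := Real.cos_le_one l
    have : 0 ≤ 1 - Real.cos l := by linarith
    positivity
  have hsinc : Continuous Real.sinc := Real.continuous_sinc
  let e : ℤ → ℝ → ℂ := fun k l => Complex.exp (-Complex.I * (k : ℂ) * (l : ℂ))
  let F₀ : ℤ → ℝ → ℝ → ℂ := fun k t l =>
    (Q l * (Real.cos (t * ω l) : ℂ) + P l * ((t * Real.sinc (t * ω l) : ℝ) : ℂ)) * e k l
  let F₁ : ℤ → ℝ → ℝ → ℂ := fun k t l =>
    (Q l * ((-(ω l * Real.sin (t * ω l)) : ℝ) : ℂ) + P l * (Real.cos (t * ω l) : ℂ)) * e k l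
  let F₂ : ℤ → ℝ → ℝ → ℂ := fun k t l => -((ω l ^ 2 : ℝ) : ℂ) * F₀ k t l
  have hF₀ : ∀ k, Continuous (Function.uncurry (F₀ k)) := fun k => by
    simp only [Function.uncurry_def, F₀, e]
    fun_prop
  have hF₁ : ∀ k, Continuous (Function.uncurry (F₁ k)) := fun k => by
    simp only [Function.uncurry_def, F₁, e]
    fun_prop
  have hF₂ : ∀ k, Continuous (Function.uncurry (F₂ k)) := fun k => by
    simp only [Function.uncurry_def, F₂, F₀, e]
    fun_prop
  have hd₀ : ∀ k t l, HasDerivAt (fun s => F₀ k s l) (F₁ k t l) t := fun k t l =>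
    (((hasDerivAt_cos_mul_const (ω l) t).ofReal_comp.const_mul (Q l)).add
      ((hasDerivAt_mul_sinc_mul (ω l) t).ofReal_comp.const_mul (P l))).mul_const (e k l)
  have hd₁ : ∀ k t l, HasDerivAt (fun s => F₁ k s l) (F₂ k t l) t := fun k t l => by
    have hsin : HasDerivAt (fun s => -(ω l * Real.sin (s * ω l)))
        (-(ω l ^ 2 * Real.cos (t * ω l))) t := by
      exact ((hasDerivAt_mul_const (ω l)).sin.const_mul (ω l)).neg.congr_deriv (by ring)
    have hsinc_eq : ω l * Real.sin (t * ω l) = ω l ^ 2 * (t * Real.sinc (t * ω l)) := by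
      rw [mul_sinc_mul]
      split_ifs with hw
      · simp [hw]
      · field_simp
    have hcos := hasDerivAt_cos_mul_const (ω l) t
    rw [hsinc_eq] at hcos
    refine (((hsin.ofReal_comp.const_mul (Q l)).add
      (hcos.ofReal_comp.const_mul (P l))).mul_const (e k l)).congr_deriv ?_
    simp only [F₂, F₀]
    push_cast
    ring
  have hq₀ : ∀ k, q k = fun t => (1 / (2 * (π : ℂ))) * ∫ l in (0:ℝ)..(2 * π), F₀ k t l :=
    fun k => funext fun t => by
      simp only [hq, F₀, e, mul_sinc_mul, apply_ite Complex.ofReal]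
  have hq₁ : ∀ k t, HasDerivAt (q k)
      ((1 / (2 * (π : ℂ))) * ∫ l in (0:ℝ)..(2 * π), F₁ k t l) t := fun k t => by
    rw [hq₀]
    exact (hasDerivAt_intervalIntegral_of_continuous _ _ (hF₀ k) (hF₁ k) (hd₀ k) t).const_mul _
  have hq₁' : ∀ k, deriv (q k) =
      fun t => (1 / (2 * (π : ℂ))) * ∫ l in (0:ℝ)..(2 * π), F₁ k t l :=
    fun k => funext fun t => (hq₁ k t).deriv
  have hq₂ : ∀ k t, HasDerivAt (deriv (q k))
      ((1 / (2 * (π : ℂ))) * ∫ l in (0:ℝ)..(2 * π), F₂ k t l) t := fun k t => by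
    rw [hq₁']
    exact (hasDerivAt_intervalIntegral_of_continuous _ _ (hF₁ k) (hF₂ k) (hd₁ k) t).const_mul _
  intro k
  refine ⟨?_, ?_, ?_, fun t => ?_⟩
  · have h1 : ContDiff ℝ 1 (deriv (q k)) := by
      rw [contDiff_one_iff_deriv, funext fun t => (hq₂ k t).deriv]
      exact ⟨fun t => (hq₂ k t).differentiableAt, continuous_const.mul
        (intervalIntegral.continuous_parametric_intervalIntegral_of_continuous' (hF₂ k) _ _)⟩
    rw [← one_add_one_eq_two, contDiff_succ_iff_deriv]
    exact ⟨fun t => (hq₁ k t).differentiableAt, by simp, h1⟩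
  · simp [hq₀, F₀, e]
  · simp [hq₁', F₁, e]
  · have hi : ∀ j, IntervalIntegrable (F₀ j t) volume 0 (2 * π) := fun j =>
      ((hF₀ j).comp (Continuous.prodMk_right t)).intervalIntegrable _ _
    have hF : ∀ l, F₂ k t l = -(ω₀ : ℂ) ^ 2 * F₀ k t l +
        (ω₁ : ℂ) ^ 2 * (F₀ (k + 1) t l - 2 * F₀ k t l + F₀ (k - 1) t l) := fun l => by
      have he : e (k + 1) l + e (k - 1) l = 2 * (Real.cos l : ℂ) * e k l :=
        exp_succ_add_exp_pred k l
      simp only [F₂, F₀, hωsq]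
      generalize Q l * (Real.cos (t * ω l) : ℂ) +
        P l * ((t * Real.sinc (t * ω l) : ℝ) : ℂ) = A
      push_cast at he ⊢
      linear_combination -(ω₁ : ℂ) ^ 2 * A * he
    rw [(hq₂ k t).deriv]
    simp only [hq₀, hF]
    rw [intervalIntegral.integral_add ((hi k).const_mul _)
        ((((hi (k + 1)).sub ((hi k).const_mul 2)).add (hi (k - 1))).const_mul _),
      intervalIntegral.integral_const_mul, intervalIntegral.integral_const_mul,
      intervalIntegral.integral_add ((hi (k + 1)).sub ((hi k).const_mul 2)) (hi (k - 1)),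
      intervalIntegral.integral_sub (hi (k + 1)) ((hi k).const_mul 2),
      intervalIntegral.integral_const_mul]
    ring
end

section
/- Fix ω₁ > 0 and let P : ℝ → ℂ be a continuously differentiable 2π-periodic function. Then for every fixed k ∈ ℤ, lim_{t→∞} (1/2π)·∫₀^{2π} P(λ)·( sin(2ω₁·t·sin(λ/2)) / (2ω₁·sin(λ/2)) )·e^{−ikλ} dλ = P(0)/(2ω₁). -/
open scoped Real
open MeasureTheory Complex Filter

/-- The Riemann-Lebesgue lemma for the sine transform over a measurable set. -/
lemma tendsto_setIntegral_sin_mul {s : Set ℝ} (hs : MeasurableSet s) {f : ℝ → ℂ}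
    (hf : IntegrableOn f s) :
    Tendsto (fun T : ℝ => ∫ x in s, (Real.sin (T * x) : ℂ) * f x) atTop (nhds 0) := by
  have hexp : ∀ c : ℝ, c ≠ 0 → Tendsto (fun T : ℝ =>
      ∫ x in s, Complex.exp (((c * T * x : ℝ) : ℂ) * I) * f x) atTop (nhds 0) := by
    intro c hc
    have hw : Tendsto (fun T : ℝ => -(c / (2 * π)) * T) atTop (cocompact ℝ) :=
      (Homeomorph.mulLeft₀ (-(c / (2 * π)))
        (by have := Real.pi_pos; simp [hc, this.ne'])).isClosedEmbedding.tendsto_cocompact.comp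
        atTop_le_cocompact
    refine ((Real.tendsto_integral_exp_smul_cocompact (s.indicator f)).comp hw).congr fun T => ?_
    rw [← integral_indicator hs]
    refine integral_congr_ae (Eventually.of_forall fun x => ?_)
    by_cases hx : x ∈ s
    · simp only [Set.indicator_of_mem hx, Circle.smul_def, Real.fourierChar_apply, smul_eq_mul]
      congr 3
      have := Real.pi_ne_zero
      norm_cast
      field_simp
    · simp [Set.indicator_of_notMem hx]
  have hInt : ∀ c T : ℝ,
      IntegrableOn (fun x => Complex.exp (((c * T * x : ℝ) : ℂ) * I) * f x) s := by
    intro c T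
    refine hf.bdd_mul (c := 1) (by fun_prop) (Eventually.of_forall fun x => ?_)
    rw [Complex.norm_exp_ofReal_mul_I]
  have h := ((hexp (-1) (by norm_num)).sub (hexp 1 one_ne_zero)).mul_const (I / 2)
  rw [sub_zero, zero_mul] at h
  refine h.congr fun T => ?_
  rw [← integral_sub (hInt _ _) (hInt _ _), ← integral_mul_const]
  refine integral_congr_ae (Eventually.of_forall fun x => ?_)
  simp only [Complex.ofReal_sin, Complex.sin]
  push_cast
  ring_nf

/-- The Riemann-Lebesgue lemma for the phase `sin` on `(0, π / 2)`. -/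
lemma tendsto_setIntegral_sin_mul_sin_mul {f : ℝ → ℂ} (hf : IntegrableOn f (Set.Ioo 0 (π / 2))) :
    Tendsto (fun T : ℝ => ∫ u in Set.Ioo 0 (π / 2), (Real.sin (T * Real.sin u) : ℂ) * f u)
      atTop (nhds 0) := by
  have hsub : Set.Ioo 0 (π / 2) ⊆ Set.Icc (-(π / 2)) (π / 2) := fun u hu =>
    ⟨by linarith [hu.1, hu.2], hu.2.le⟩
  have hinj : Set.InjOn Real.sin (Set.Ioo 0 (π / 2)) := Real.injOn_sin.mono hsub
  have hderiv : ∀ u ∈ Set.Ioo 0 (π / 2),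
      HasDerivWithinAt Real.sin (Real.cos u) (Set.Ioo 0 (π / 2)) u :=
    fun u _ => (Real.hasDerivAt_sin u).hasDerivWithinAt
  have himg : MeasurableSet (Real.sin '' Set.Ioo 0 (π / 2)) :=
    measurableSet_Ioo.image_of_continuousOn_injOn Real.continuous_sin.continuousOn hinj
  let g : ℝ → ℂ := fun x => |Real.cos (Real.arcsin x)|⁻¹ • f (Real.arcsin x)
  have hg : ∀ u ∈ Set.Ioo 0 (π / 2), |Real.cos u| • g (Real.sin u) = f u := by
    intro u hu
    have hcos : 0 < Real.cos u :=
      Real.cos_pos_of_mem_Ioo ⟨by linarith [hu.1, hu.2], hu.2⟩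
    simp only [g, Real.arcsin_sin (hsub hu).1 (hsub hu).2]
    rw [smul_inv_smul₀ (abs_pos.2 hcos.ne').ne']
  have hgint : IntegrableOn g (Real.sin '' Set.Ioo 0 (π / 2)) := by
    rw [integrableOn_image_iff_integrableOn_abs_deriv_smul measurableSet_Ioo hderiv hinj]
    exact hf.congr_fun (fun u hu => (hg u hu).symm) measurableSet_Ioo
  refine (tendsto_setIntegral_sin_mul himg hgint).congr fun T => ?_
  rw [integral_image_eq_integral_abs_deriv_smul measurableSet_Ioo hderiv hinj]
  refine setIntegral_congr_fun measurableSet_Ioo fun u hu => ?_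
  change |Real.cos u| • ((Real.sin (T * Real.sin u) : ℂ) * g (Real.sin u)) = _
  rw [← mul_smul_comm, hg u hu]

lemma mul_sinc_mul_s9 (T : ℝ) {s : ℝ} (hs : s ≠ 0) :
    T * Real.sinc (T * s) = Real.sin (T * s) / s := by
  rcases eq_or_ne T 0 with rfl | hT
  · simp
  · rw [Real.sinc_of_ne_zero (mul_ne_zero hT hs)]
    field_simp

/-- The integral of the Dirichlet kernel over a half period. -/
lemma intervalIntegrable_and_integral_dirichletKernel (n : ℕ) :
    IntervalIntegrable (fun u => Real.sin ((2 * n + 1) * u) / Real.sin u) volume 0 (π / 2) ∧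
      ∫ u in (0:ℝ)..(π / 2), Real.sin ((2 * n + 1) * u) / Real.sin u = π / 2 := by
  have hsin : ∀ u ∈ Set.uIoc 0 (π / 2), Real.sin u ≠ 0 := by
    intro u hu
    rw [Set.uIoc_of_le (by positivity)] at hu
    exact (Real.sin_pos_of_pos_of_lt_pi hu.1 (by linarith [hu.2, Real.pi_pos])).ne'
  induction n with
  | zero =>
    have h : Set.EqOn (fun _ : ℝ => (1 : ℝ))
        (fun u => Real.sin ((2 * (0 : ℕ) + 1) * u) / Real.sin u) (Set.uIoc 0 (π / 2)) := by
      intro u hu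
      simp [div_self (hsin u hu)]
    refine ⟨intervalIntegrable_const.congr h, ?_⟩
    rw [← intervalIntegral.integral_congr_ae (Eventually.of_forall h)]
    simp
  | succ n ih =>
    have hcos : IntervalIntegrable (fun u => 2 * Real.cos ((2 * n + 2) * u)) volume 0 (π / 2) :=
      Continuous.intervalIntegrable (by fun_prop) _ _
    have h : Set.EqOn
        (fun u => Real.sin ((2 * n + 1) * u) / Real.sin u + 2 * Real.cos ((2 * n + 2) * u))
        (fun u => Real.sin ((2 * (n + 1 : ℕ) + 1) * u) / Real.sin u) (Set.uIoc 0 (π / 2)) := by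
      intro u hu
      have hs := hsin u hu
      simp only
      rw [div_add' _ _ _ hs]
      congr 1
      have h1 : (2 * (n : ℝ) + 1) * u = (2 * n + 2) * u - u := by ring
      have h2 : (2 * ((n + 1 : ℕ) : ℝ) + 1) * u = (2 * n + 2) * u + u := by push_cast; ring
      rw [h1, h2, Real.sin_sub, Real.sin_add]
      ring
    refine ⟨(ih.1.add hcos).congr h, ?_⟩
    rw [← intervalIntegral.integral_congr_ae (Eventually.of_forall h), intervalIntegral.integral_add ih.1 hcos, ih.2,
      intervalIntegral.integral_const_mul, intervalIntegral.integral_comp_mul_left _ (by positivity),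
      integral_cos, show (2 * (n : ℝ) + 2) * (π / 2) = (n + 1 : ℕ) * π by push_cast; ring,
      Real.sin_nat_mul_pi]
    simp

lemma integrableOn_inv_sin_sub_inv :
    IntegrableOn (fun u : ℝ => (Real.sin u)⁻¹ - u⁻¹) (Set.Ioo 0 (π / 2)) := by
  refine IntegrableOn.of_bound (by simp) (by fun_prop) 1 ?_
  refine (ae_restrict_iff' measurableSet_Ioo).2 (Eventually.of_forall fun u hu => ?_)
  have hs : 0 < Real.sin u := Real.sin_pos_of_pos_of_lt_pi hu.1 (by linarith [hu.2, Real.pi_pos])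
  have h1 : u / 2 ≤ Real.sin u := by
    refine le_trans ?_ (Real.mul_le_sin hu.1.le hu.2.le)
    rw [div_mul_eq_mul_div, div_le_div_iff₀ two_pos Real.pi_pos]
    nlinarith [Real.pi_le_four, hu.1]
  have h2 := Real.sin_ge_sub_cube hu.1.le
  have h3 := Real.sin_le hu.1.le
  have h4 : u < 2 := by linarith [hu.2, Real.pi_le_four]
  have h5 : u ^ 3 ≤ 2 * u ^ 2 := by nlinarith [mul_nonneg (sq_nonneg u) (sub_nonneg.2 h4.le)]
  rw [inv_sub_inv hs.ne' hu.1.ne', Real.norm_of_nonneg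
    (div_nonneg (by linarith) (mul_pos hs hu.1).le), div_le_one (mul_pos hs hu.1)]
  nlinarith [mul_le_mul_of_nonneg_right h1 hu.1.le]

lemma tendsto_integral_sinc_odd_mul_pi_div_two :
    Tendsto (fun n : ℕ => ∫ x in (0:ℝ)..((2 * n + 1) * (π / 2)), Real.sinc x)
      atTop (nhds (π / 2)) := by
  have hT : Tendsto (fun n : ℕ => 2 * (n : ℝ) + 1) atTop atTop :=
    tendsto_atTop_add_const_right _ _ (tendsto_natCast_atTop_atTop.const_mul_atTop two_pos)
  have h := (Complex.continuous_re.tendsto 0).comp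
    ((tendsto_setIntegral_sin_mul measurableSet_Ioo integrableOn_inv_sin_sub_inv.ofReal).comp hT)
  have h' := h.const_sub (π / 2)
  rw [Complex.zero_re, sub_zero] at h'
  refine h'.congr fun n => ?_
  obtain ⟨hInt, hval⟩ := intervalIntegrable_and_integral_dirichletKernel n
  have hsinc : ∫ x in (0:ℝ)..((2 * n + 1) * (π / 2)), Real.sinc x =
      ∫ u in (0:ℝ)..(π / 2), (2 * n + 1) * Real.sinc ((2 * n + 1) * u) := by
    rw [intervalIntegral.integral_const_mul, intervalIntegral.mul_integral_comp_mul_left, mul_zero]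
  have hX : ∫ u in (0:ℝ)..(π / 2), Real.sin ((2 * n + 1) * u) * ((Real.sin u)⁻¹ - u⁻¹) =
      π / 2 - ∫ x in (0:ℝ)..((2 * n + 1) * (π / 2)), Real.sinc x := by
    have hcont : Continuous fun u : ℝ => (2 * n + 1) * Real.sinc ((2 * n + 1) * u) := by fun_prop
    refine Eq.trans ?_ ((intervalIntegral.integral_sub hInt (hcont.intervalIntegrable _ _)).trans
      (by rw [hval, hsinc]))
    refine intervalIntegral.integral_congr_ae (Eventually.of_forall fun u hu => ?_)
    rw [Set.uIoc_of_le (by positivity)] at hu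
    rw [mul_sinc_mul_s9 _ hu.1.ne']
    ring
  have hY : ∫ u in Set.Ioo 0 (π / 2),
      (Real.sin ((2 * n + 1) * u) : ℂ) * (((Real.sin u)⁻¹ - u⁻¹ : ℝ) : ℂ) =
      (π / 2 - ∫ x in (0:ℝ)..((2 * n + 1) * (π / 2)), Real.sinc x : ℝ) := by
    rw [← hX, intervalIntegral.integral_of_le (by positivity), integral_Ioc_eq_integral_Ioo,
      ← integral_complex_ofReal]
    push_cast
    rfl
  exact (congrArg (fun z : ℂ => π / 2 - z.re) hY).trans (by simp)

lemma abs_sinc_le_inv {x : ℝ} (hx : 0 < x) : |Real.sinc x| ≤ x⁻¹ := by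
  rw [Real.sinc_of_ne_zero hx.ne', abs_div, abs_of_pos hx, div_eq_mul_inv]
  exact mul_le_of_le_one_left (inv_nonneg.2 hx.le) (Real.abs_sin_le_one x)

/-- The Dirichlet integral. -/
lemma tendsto_integral_sinc :
    Tendsto (fun T : ℝ => ∫ x in (0:ℝ)..T, Real.sinc x) atTop (nhds (π / 2)) := by
  have hpi := Real.pi_pos
  have hInt : ∀ a b, IntervalIntegrable Real.sinc volume a b := fun a b =>
    Real.continuous_sinc.intervalIntegrable a b
  have hfloor : Tendsto (fun T : ℝ => ⌊T / π⌋₊) atTop atTop :=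
    tendsto_nat_floor_atTop.comp (tendsto_id.atTop_div_const hpi)
  have hmain := tendsto_integral_sinc_odd_mul_pi_div_two.comp hfloor
  have herr : Tendsto (fun T : ℝ =>
      ∫ x in ((2 * (⌊T / π⌋₊ : ℝ) + 1) * (π / 2))..T, Real.sinc x) atTop (nhds 0) := by
    have hbound : Tendsto (fun T : ℝ => (T - π / 2)⁻¹ * (π / 2)) atTop (nhds 0) := by
      have := (tendsto_inv_atTop_zero.comp
        (tendsto_atTop_add_const_right atTop (-(π / 2)) tendsto_id)).mul_const (π / 2)
      simpa [Function.comp_def, sub_eq_add_neg] using this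
    refine squeeze_zero_norm' ?_ hbound
    filter_upwards [eventually_gt_atTop (π / 2)] with T hT
    have h1 : (⌊T / π⌋₊ : ℝ) * π ≤ T :=
      (le_div_iff₀ hpi).1 (Nat.floor_le (div_nonneg (by linarith) hpi.le))
    have h2 : T < ((⌊T / π⌋₊ : ℝ) + 1) * π := (div_lt_iff₀ hpi).1 (Nat.lt_floor_add_one _)
    have hT' : 0 < T - π / 2 := by linarith
    have hdist : |T - (2 * (⌊T / π⌋₊ : ℝ) + 1) * (π / 2)| ≤ π / 2 := by
      rw [abs_le]; constructor <;> linarith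
    refine (intervalIntegral.norm_integral_le_of_norm_le_const (C := (T - π / 2)⁻¹)
      fun x hx => ?_).trans (mul_le_mul_of_nonneg_left hdist (inv_nonneg.2 hT'.le))
    have hx' : T - π / 2 ≤ x := by
      rcases Set.mem_uIoc.1 hx with h | h <;> linarith [h.1, (abs_le.1 hdist).2]
    exact (abs_sinc_le_inv (hT'.trans_le hx')).trans (inv_anti₀ hT' hx')
  have h := hmain.add herr
  rw [add_zero] at h
  exact h.congr fun T => intervalIntegral.integral_add_adjacent_intervals (hInt _ _) (hInt _ _)

/-- The kernel `sin (T * sin u) / sin u` on `[0, π / 2]` tends to `π / 2` times the evaluation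
at `0`. -/
lemma tendsto_integral_mul_sinc_mul_sin {G : ℝ → ℂ} (hG : Continuous G)
    (hG' : DifferentiableAt ℝ G 0) :
    Tendsto (fun T : ℝ => ∫ u in (0:ℝ)..(π / 2), ((T * Real.sinc (T * Real.sin u) : ℝ) : ℂ) * G u)
      atTop (nhds (π / 2 * G 0)) := by
  have hpi := Real.pi_pos
  set N : ℝ → ℂ := fun u => G u - Real.cos u * G 0 with hN
  have hNd : DifferentiableAt ℝ N 0 := by
    have h1 : DifferentiableAt ℝ (fun u : ℝ => (Real.cos u : ℂ)) 0 :=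
      (Real.hasDerivAt_cos 0).ofReal_comp.differentiableAt
    exact hG'.sub (h1.mul_const _)
  have hNc : Continuous N := by fun_prop
  have hsinc : ∀ u ∈ Set.Icc 0 (π / 2), Real.sinc u ≠ 0 := by
    intro u hu
    rcases hu.1.eq_or_lt with rfl | h
    · simp
    · rw [Real.sinc_of_ne_zero h.ne']
      exact (div_pos (Real.sin_pos_of_pos_of_lt_pi h (by linarith [hu.2])) h).ne'
  let F : ℝ → ℂ := fun u => (Real.sinc u)⁻¹ • dslope N 0 u
  have hF : ContinuousOn F (Set.Icc 0 (π / 2)) := by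
    refine (Real.continuous_sinc.continuousOn.inv₀ hsinc).smul ?_
    exact ((continuousOn_dslope univ_mem).2 ⟨hNc.continuousOn, hNd⟩).mono (Set.subset_univ _)
  have hFint : IntegrableOn F (Set.Ioo 0 (π / 2)) :=
    hF.integrableOn_Icc.mono_set Set.Ioo_subset_Icc_self
  have h := (tendsto_setIntegral_sin_mul_sin_mul hFint).add
    (((Complex.continuous_ofReal.tendsto _).comp tendsto_integral_sinc).mul_const (G 0))
  rw [zero_add] at h
  push_cast at h
  refine h.congr fun T => ?_
  have hS : ∫ x in (0:ℝ)..T, Real.sinc x =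
      ∫ u in (0:ℝ)..(π / 2), T * Real.sinc (T * Real.sin u) * Real.cos u := by
    have := intervalIntegral.integral_comp_mul_deriv (a := 0) (b := π / 2) (f := Real.sin)
      (f' := Real.cos) (g := fun x => T * Real.sinc (T * x))
      (fun u _ => Real.hasDerivAt_sin u) Real.continuous_cos.continuousOn (by fun_prop)
    simp only [Function.comp_def, Real.sin_zero, Real.sin_pi_div_two] at this
    rw [this, intervalIntegral.integral_const_mul, intervalIntegral.mul_integral_comp_mul_left]
    simp
  simp only [Function.comp_apply]
  rw [← integral_Ioc_eq_integral_Ioo, ← intervalIntegral.integral_of_le (by positivity), hS,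
    ← intervalIntegral.integral_ofReal, ← intervalIntegral.integral_mul_const,
    ← intervalIntegral.integral_add]
  · refine intervalIntegral.integral_congr_ae (Eventually.of_forall fun u hu => ?_)
    rw [Set.uIoc_of_le (by positivity)] at hu
    have hs : Real.sin u ≠ 0 := (Real.sin_pos_of_pos_of_lt_pi hu.1 (by linarith [hu.2])).ne'
    have hu0 : u ≠ 0 := hu.1.ne'
    rw [mul_sinc_mul_s9 T hs]
    have hs' : (Real.sin u : ℂ) ≠ 0 := by exact_mod_cast hs
    have hu' : (u : ℂ) ≠ 0 := by exact_mod_cast hu0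
    simp only [F, dslope_of_ne _ hu0, slope_def_module, Real.sinc_of_ne_zero hu0, hN,
      Complex.real_smul, Real.cos_zero, sub_zero]
    push_cast at hs' ⊢
    field_simp
    ring
  · rw [intervalIntegrable_iff_integrableOn_Icc_of_le (by positivity)]
    exact ContinuousOn.integrableOn_Icc (ContinuousOn.mul (by fun_prop) hF)
  · exact Continuous.intervalIntegrable (by fun_prop) _ _

lemma tendsto_integral_mul_sinc_mul_sin_half {G : ℝ → ℂ} (hG : Continuous G)
    (hG' : DifferentiableAt ℝ G 0) :
    Tendsto (fun T : ℝ =>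
      ∫ l in (0:ℝ)..π, ((T * Real.sinc (T * Real.sin (l / 2)) : ℝ) : ℂ) * G l)
      atTop (nhds (π * G 0)) := by
  have hd : DifferentiableAt ℝ (fun u : ℝ => G (2 * u)) 0 :=
    DifferentiableAt.comp (g := G) (f := fun u : ℝ => 2 * u) 0 (by simpa using hG') (by fun_prop)
  have h := (tendsto_integral_mul_sinc_mul_sin (by fun_prop) hd).const_mul 2
  rw [mul_zero, show (2 : ℂ) * (π / 2 * G 0) = π * G 0 by ring] at h
  refine h.congr fun T => ?_
  have := intervalIntegral.smul_integral_comp_mul_left (a := 0) (b := π / 2)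
    (fun l => ((T * Real.sinc (T * Real.sin (l / 2)) : ℝ) : ℂ) * G l) 2
  simpa [mul_div_cancel₀] using this

/-- For `ω₀ = 0` the velocity contribution to the solution converges,
for every fixed `k`, to `P(0)/(2ω₁)` as `t → ∞`. -/
theorem velocity_contribution_limit (ω₁ : ℝ) (hω₁ : 0 < ω₁)
    (P : ℝ → ℂ) (hP : ContDiff ℝ 1 P) (hPper : Function.Periodic P (2 * π)) (k : ℤ) :
    Tendsto (fun t : ℝ =>
        (1 / (2 * (π : ℂ))) * ∫ l in (0:ℝ)..(2 * π),
          P l * (if 2 * ω₁ * Real.sin (l / 2) = 0 then (t : ℂ)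
              else ((Real.sin (2 * ω₁ * t * Real.sin (l / 2)) /
                  (2 * ω₁ * Real.sin (l / 2)) : ℝ) : ℂ)) *
            Complex.exp (-Complex.I * (k : ℂ) * (l : ℂ)))
      atTop (nhds (P 0 / (2 * (ω₁ : ℂ)))) := by
  have hω : (ω₁ : ℂ) ≠ 0 := by exact_mod_cast hω₁.ne'
  have hpi : (π : ℂ) ≠ 0 := by exact_mod_cast Real.pi_ne_zero
  let G : ℝ → ℂ := fun l => P l * Complex.exp (-I * k * l)
  have hPc : Continuous P := hP.continuous
  have hGc : Continuous G := by fun_prop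
  have hexp : Differentiable ℝ fun l : ℝ => Complex.exp (-I * k * l) := fun l =>
    (((hasDerivAt_id l).ofReal_comp.const_mul (-I * (k : ℂ))).cexp).differentiableAt
  have hGd : Differentiable ℝ G := (hP.differentiable one_ne_zero).mul hexp
  have hGper : ∀ l, G (2 * π - l) = G (-l) := by
    intro l
    have h1 : P (2 * π - l) = P (-l) := hPper.sub_eq'
    have h2 : Complex.exp (-I * k * ((2 * π - l : ℝ) : ℂ)) =
        Complex.exp (-I * k * ((-l : ℝ) : ℂ)) := by
      rw [Complex.exp_eq_exp_iff_exists_int]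
      exact ⟨-k, by push_cast; ring⟩
    simp only [G, h1, h2]
  have hscale : Tendsto (fun t : ℝ => 2 * ω₁ * t) atTop atTop :=
    tendsto_id.const_mul_atTop (by positivity)
  have hlim := (((tendsto_integral_mul_sinc_mul_sin_half hGc (hGd 0)).add
    (tendsto_integral_mul_sinc_mul_sin_half (G := fun l => G (-l)) (by fun_prop)
      ((hGd.comp differentiable_neg) 0))).comp hscale).const_mul
        ((1 / (2 * (π : ℂ))) * (1 / (2 * ω₁)))
  have hG0 : G 0 = P 0 := by simp [G]
  rw [neg_zero, hG0, show (1 / (2 * (π : ℂ))) * (1 / (2 * ω₁)) * (π * P 0 + π * P 0) =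
    P 0 / (2 * ω₁) by field_simp; ring] at hlim
  refine hlim.congr fun t => ?_
  let f : ℝ → ℂ := fun l =>
    ((2 * ω₁ * t * Real.sinc (2 * ω₁ * t * Real.sin (l / 2)) : ℝ) : ℂ) * G l
  have hf : Continuous f := by fun_prop
  have hrefl : ∫ l in (0:ℝ)..π,
      ((2 * ω₁ * t * Real.sinc (2 * ω₁ * t * Real.sin (l / 2)) : ℝ) : ℂ) * G (-l) =
      ∫ l in π..(2 * π), f l := by
    have h := intervalIntegral.integral_comp_sub_left (a := 0) (b := π) f (2 * π)
    rw [sub_zero, show 2 * π - π = π by ring] at h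
    rw [← h]
    refine intervalIntegral.integral_congr fun l _ => ?_
    simp only [f, hGper, show (2 * π - l) / 2 = π - l / 2 by ring, Real.sin_pi_sub]
  simp only [Function.comp_apply]
  rw [hrefl, intervalIntegral.integral_add_adjacent_intervals (hf.intervalIntegrable _ _)
    (hf.intervalIntegrable _ _), mul_assoc, ← intervalIntegral.integral_const_mul]
  congr 1
  refine intervalIntegral.integral_congr fun l _ => ?_
  simp only [f, G]
  split_ifs with h
  · have hs : Real.sin (l / 2) = 0 := by simpa [hω₁.ne'] using h
    rw [hs]
    simp only [mul_zero, Real.sinc_zero]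
    push_cast
    field_simp
  · have hs : Real.sin (l / 2) ≠ 0 := right_ne_zero_of_mul h
    have hs' : (Real.sin (l / 2) : ℂ) ≠ 0 := by exact_mod_cast hs
    rw [mul_sinc_mul_s9 _ hs]
    push_cast at hs' ⊢
    field_simp
end

section
/- For 0 < α < 1/2 define a_α = √( Γ(1−α) / (2√π·Γ(1/2 − α)) ) and φ(α) = 2a_α·(Γ(1−α)/(π·α))·cos(π·α/2). Then for every 0 < ε < 1/2 the function w_ε(α) = 1 / ( φ(α)·(1/2 − α)^{1/2 − ε} ) is Lebesgue integrable on the interval (0, 1/2), i.e. ∫₀^{1/2} w_ε(α) dα < ∞. -/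
open scoped Real
open MeasureTheory

/-- The weight function `w_ε(α) = 1/(φ(α)(1/2 − α)^{1/2−ε})` is
Lebesgue integrable on `(0, 1/2)`. -/
theorem weight_function_integrable (ε : ℝ) (hε0 : 0 < ε) (hε : ε < 1 / 2)
    (a : ℝ → ℝ)
    (ha : ∀ α : ℝ, a α =
      Real.sqrt (Real.Gamma (1 - α) / (2 * Real.sqrt π * Real.Gamma (1 / 2 - α))))
    (φ : ℝ → ℝ)
    (hφ : ∀ α : ℝ, φ α = 2 * a α * (Real.Gamma (1 - α) / (π * α)) * Real.cos (π * α / 2)) :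
    IntegrableOn (fun α : ℝ => 1 / (φ α * (1 / 2 - α) ^ ((1:ℝ) / 2 - ε)))
      (Set.Ioo (0 : ℝ) (1 / 2)) := by
  have hrpow : IntegrableOn (fun α : ℝ => (1 / 2 - α) ^ (ε - 1)) (Set.Icc 0 (1 / 2)) := by
    have h := (intervalIntegral.intervalIntegrable_rpow' (a := 1 / 2) (b := 0)
      (r := ε - 1) (by linarith)).comp_sub_left (1 / 2)
    rw [sub_self, sub_zero] at h
    rwa [intervalIntegrable_iff_integrableOn_Icc_of_le (by norm_num)] at h
  have hGamma : ∀ c : ℝ, 1 ≤ c →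
      ContinuousOn (fun α : ℝ => Real.Gamma (c - α)) (Set.Icc 0 (1 / 2)) := by
    intro c hc α hα
    have hpos : 0 < c - α := by linarith [hα.2]
    refine ContinuousAt.continuousWithinAt (ContinuousAt.comp (g := Real.Gamma) ?_ (by fun_prop))
    refine (Real.differentiableAt_Gamma fun m => ?_).continuousAt
    have : (0 : ℝ) ≤ m := m.cast_nonneg
    linarith
  have hcos : ∀ α ∈ Set.Icc (0 : ℝ) (1 / 2), 0 < Real.cos (π * α / 2) := by
    intro α hα
    have := Real.pi_pos
    apply Real.cos_pos_of_mem_Ioo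
    constructor <;> nlinarith [hα.1, hα.2]
  have hG : ∀ c : ℝ, 1 ≤ c → ∀ α ∈ Set.Icc (0 : ℝ) (1 / 2), 0 < Real.Gamma (c - α) :=
    fun c hc α hα => Real.Gamma_pos_of_pos (by linarith [hα.2])
  let g : ℝ → ℝ := fun α => Real.Gamma (1 - α) / (2 * √π * Real.Gamma (3 / 2 - α))
  have hg : ∀ α ∈ Set.Icc (0 : ℝ) (1 / 2), 0 < g α := by
    intro α hα
    have h1 := hG 1 le_rfl α hα
    have h2 := hG (3 / 2) (by norm_num) α hα
    have := Real.pi_pos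
    positivity
  have hgc : ContinuousOn g (Set.Icc 0 (1 / 2)) := by
    refine (hGamma 1 le_rfl).div (continuousOn_const.mul (hGamma (3 / 2) (by norm_num))) ?_
    intro α hα
    have h2 := hG (3 / 2) (by norm_num) α hα
    have := Real.pi_pos
    positivity
  have hcont : ContinuousOn (fun α : ℝ => π * α /
      (2 * √(g α) * Real.Gamma (1 - α) * Real.cos (π * α / 2))) (Set.Icc 0 (1 / 2)) := by
    refine ContinuousOn.div (by fun_prop) (((continuousOn_const.mul hgc.sqrt).mul
      (hGamma 1 le_rfl)).mul (by fun_prop)) fun α hα => ?_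
    have h1 := hG 1 le_rfl α hα
    have h2 := hg α hα
    have h3 := hcos α hα
    positivity
  refine ((hrpow.continuousOn_mul hcont isCompact_Icc).mono_set
    Set.Ioo_subset_Icc_self).congr_fun (fun α hα => ?_) measurableSet_Ioo
  have hα' := Set.Ioo_subset_Icc_self hα
  have hα0 : 0 < α := hα.1
  have hβ : 0 < 1 / 2 - α := by linarith [hα.2]
  have h1 := hG 1 le_rfl α hα'
  have h2 := hg α hα'
  have h3 := hcos α hα'
  have hsqrt : a α = √(g α) * (1 / 2 - α) ^ ((1 : ℝ) / 2) := by
    rw [← Real.sqrt_eq_rpow, ← Real.sqrt_mul h2.le, ha]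
    congr 1
    have hrec := Real.Gamma_add_one hβ.ne'
    rw [show 1 / 2 - α + 1 = 3 / 2 - α by ring] at hrec
    have h4 := Real.Gamma_pos_of_pos hβ
    have := Real.pi_pos
    simp only [g, hrec]
    generalize Real.Gamma (1 / 2 - α) = t at *
    generalize 1 / 2 - α = β at *
    field_simp
  have hpow : (1 / 2 - α) ^ (ε - 1) =
      ((1 / 2 - α) ^ ((1 : ℝ) / 2) * (1 / 2 - α) ^ ((1 : ℝ) / 2 - ε))⁻¹ := by
    rw [← Real.rpow_add hβ, ← Real.rpow_neg hβ.le]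
    congr 1
    ring
  have hp1 := Real.rpow_pos_of_pos hβ (1 / 2)
  have hp2 := Real.rpow_pos_of_pos hβ (1 / 2 - ε)
  have := Real.pi_pos
  simp only [hφ, hsqrt, hpow]
  generalize (1 / 2 - α) ^ ((1 : ℝ) / 2) = x at *
  generalize (1 / 2 - α) ^ ((1 : ℝ) / 2 - ε) = y at *
  generalize Real.cos (π * α / 2) = z at *
  field_simp
end

section
/- Fix ω₀ > 0 and ω₁ > 0, set ω(λ) = √(ω₀² + 2ω₁²(1 − cos λ)) and ω₀' = √(ω₀² + 4ω₁²). Let g : ℝ → ℂ be a twice continuously differentiable 2π-periodic function, and define E[g](t) = (1/2π)·∫₀^{2π} g(λ)·e^{i·t·ω(λ)} dλ. Then, with c₁ = (1/ω₁)·√(ω₀/(2π)) and c₂ = (1/ω₁)·√(ω₀'/(2π)), one has lim_{t→∞} [ √t·E[g](t) − ( c₁·g(0)·e^{i(t·ω₀ + π/4)} + c₂·g(π)·e^{i(t·ω₀' − π/4)} ) ] = 0. -/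
open scoped Real
open MeasureTheory Complex Filter
open Topology

theorem norm_integral_cexp_neg_mul_sq_le {b : ℂ} (hb : 0 ≤ b.re) (hb0 : b ≠ 0) {R S : ℝ}
    (hR : 0 < R) (hRS : R ≤ S) :
    ‖∫ x in R..S, cexp (-b * (x : ℂ) ^ 2)‖ ≤ 1 / (‖b‖ * R) := by
  have hpos : ∀ x ∈ Set.uIcc R S, 0 < x := fun x hx => by
    rw [Set.uIcc_of_le hRS] at hx; exact hR.trans_le hx.1
  have hexp : ∀ x : ℝ, ‖cexp (-b * (x : ℂ) ^ 2)‖ ≤ 1 := fun x => by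
    rw [Complex.norm_exp, Real.exp_le_one_iff, ← ofReal_pow, re_mul_ofReal]
    have := mul_nonneg hb (sq_nonneg x)
    simp only [neg_re]; linarith
  have hne : ∀ x ∈ Set.uIcc R S, (x : ℂ) ≠ 0 := fun x hx => ofReal_ne_zero.2 (hpos x hx).ne'
  have hinv : ∀ x ∈ Set.uIcc R S, HasDerivAt (fun y : ℝ => (y : ℂ)⁻¹) (-((x : ℂ) ^ 2)⁻¹) x :=
    fun x hx => (hasDerivAt_inv (hne x hx)).comp_ofReal
  have hE : ∀ x : ℝ, HasDerivAt (fun y : ℝ => cexp (-b * (y : ℂ) ^ 2))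
      (cexp (-b * (x : ℂ) ^ 2) * (-b * (2 * (x : ℂ)))) x := fun x => by
    have h := ((hasDerivAt_pow 2 (x : ℂ)).const_mul (-b)).cexp.comp_ofReal
    simpa using h
  have hcinv : ContinuousOn (fun y : ℝ => -((y : ℂ) ^ 2)⁻¹) (Set.uIcc R S) :=
    ((by fun_prop : Continuous fun y : ℝ => (y : ℂ) ^ 2).continuousOn.inv₀
      fun x hx => pow_ne_zero 2 (hne x hx)).neg
  have hparts := intervalIntegral.integral_mul_deriv_eq_deriv_mul hinv (fun x _ => hE x)
    hcinv.intervalIntegrable (Continuous.intervalIntegrable (by fun_prop) _ _)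
  have hlhs : ∫ x in R..S, (x : ℂ)⁻¹ * (cexp (-b * (x : ℂ) ^ 2) * (-b * (2 * (x : ℂ)))) =
      -(2 * b) * ∫ x in R..S, cexp (-b * (x : ℂ) ^ 2) := by
    rw [← intervalIntegral.integral_const_mul]
    refine intervalIntegral.integral_congr fun x hx => ?_
    have := hne x hx
    field_simp
  have hS : 0 < S := hR.trans_le hRS
  have hrem : ‖∫ x in R..S, -((x : ℂ) ^ 2)⁻¹ * cexp (-b * (x : ℂ) ^ 2)‖ ≤ R⁻¹ - S⁻¹ := by
    have hcont : ContinuousOn (fun x : ℝ => (x ^ 2)⁻¹) (Set.uIcc R S) :=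
      (continuous_pow 2).continuousOn.inv₀ fun x hx => pow_ne_zero 2 (hpos x hx).ne'
    have hint : ∫ x in R..S, (x ^ 2)⁻¹ = R⁻¹ - S⁻¹ := by
      rw [intervalIntegral.integral_eq_sub_of_hasDerivAt (f := fun x => -x⁻¹)
        (fun x hx => by simpa using! (hasDerivAt_inv (hpos x hx).ne').neg)
        hcont.intervalIntegrable]
      ring
    rw [← hint]
    refine intervalIntegral.norm_integral_le_of_norm_le hRS (ae_of_all _ fun x _ => ?_)
      hcont.intervalIntegrable
    rw [norm_mul, norm_neg, norm_inv, norm_pow, norm_real, Real.norm_eq_abs, sq_abs]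
    exact mul_le_of_le_one_right (by positivity) (hexp x)
  have hbd : ∀ x : ℝ, 0 < x → ‖(x : ℂ)⁻¹ * cexp (-b * (x : ℂ) ^ 2)‖ ≤ x⁻¹ := fun x hx => by
    rw [norm_mul, norm_inv, norm_real, Real.norm_of_nonneg hx.le]
    exact mul_le_of_le_one_right (by positivity) (hexp x)
  have hnb : 0 < ‖b‖ := norm_pos_iff.2 hb0
  have htot : ‖-(2 * b) * ∫ x in R..S, cexp (-b * (x : ℂ) ^ 2)‖ ≤ 2 * R⁻¹ := by
    rw [← hlhs, hparts]
    refine (norm_sub_le _ _).trans ?_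
    have := norm_sub_le ((S : ℂ)⁻¹ * cexp (-b * (S : ℂ) ^ 2)) ((R : ℂ)⁻¹ * cexp (-b * (R : ℂ) ^ 2))
    linarith [hbd S hS, hbd R hR]
  rw [norm_mul, norm_neg, norm_mul, Complex.norm_ofNat] at htot
  rw [le_div_iff₀ (by positivity)]
  have := mul_le_mul_of_nonneg_right htot hR.le
  rw [mul_assoc 2 R⁻¹, inv_mul_cancel₀ hR.ne'] at this
  linarith

theorem norm_integral_cexp_neg_mul_sq_sub_le {b : ℂ} (hb : 0 ≤ b.re) (hb0 : b ≠ 0) {R : ℝ}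
    (hR : 0 < R) :
    ‖(∫ x in (0 : ℝ)..R, cexp (-b * (x : ℂ) ^ 2)) - (π / b) ^ (1 / 2 : ℂ) / 2‖
      ≤ 1 / (‖b‖ * R) := by
  have hint : ∀ (c : ℂ) (p q : ℝ),
      IntervalIntegrable (fun x : ℝ => cexp (-c * (x : ℂ) ^ 2)) volume p q := fun c p q =>
    Continuous.intervalIntegrable (by fun_prop) _ _
  have key : ∀ c : ℂ, 0 < c.re →
      ‖(∫ x in (0 : ℝ)..R, cexp (-c * (x : ℂ) ^ 2)) - (π / c) ^ (1 / 2 : ℂ) / 2‖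
        ≤ 1 / (‖c‖ * R) := fun c hc => by
    have hlim := intervalIntegral_tendsto_integral_Ioi 0
      (integrable_cexp_neg_mul_sq hc).integrableOn tendsto_id
    rw [integral_gaussian_complex_Ioi hc] at hlim
    refine le_of_tendsto (tendsto_const_nhds.sub hlim).norm ?_
    filter_upwards [eventually_ge_atTop R] with S hS
    rw [norm_sub_rev, id, intervalIntegral.integral_interval_sub_left (hint c _ _) (hint c _ _)]
    exact norm_integral_cexp_neg_mul_sq_le hc.le (fun h => by simp [h] at hc) hR hS
  have hne : ∀ δ : ℝ, 0 ≤ δ → b + δ ≠ 0 := fun δ hδ h => hb0 <| by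
    have h1 := congrArg re h
    have h2 := congrArg im h
    simp at h1 h2
    exact Complex.ext (by simp; linarith) (by simp [h2])
  have hslit : (π : ℂ) / b ∈ slitPlane := by
    have hn : 0 < normSq b := normSq_pos.2 hb0
    rw [mem_slitPlane_iff, div_re, div_im]
    simp only [ofReal_re, ofReal_im, zero_mul, zero_div, add_zero, zero_sub]
    rcases hb.lt_or_eq with h | h
    · exact Or.inl (by have := Real.pi_pos; positivity)
    · refine Or.inr (neg_ne_zero.2 (div_ne_zero (mul_ne_zero Real.pi_ne_zero fun him => hb0 ?_) hn.ne'))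
      exact Complex.ext h.symm him
  have hcont : Tendsto (fun δ : ℝ => b + (δ : ℂ)) (𝓝[>] 0) (𝓝 b) := by
    have : Continuous fun δ : ℝ => b + (δ : ℂ) := by fun_prop
    simpa using (this.tendsto 0).mono_left nhdsWithin_le_nhds
  have hI : Continuous fun c : ℂ => ∫ x in (0 : ℝ)..R, cexp (-c * (x : ℂ) ^ 2) :=
    intervalIntegral.continuous_parametric_intervalIntegral_of_continuous' (by fun_prop) _ _
  refine le_of_tendsto_of_tendsto
    (((hI.tendsto b).comp hcont).sub
      (((tendsto_const_nhds.div hcont hb0).cpow tendsto_const_nhds hslit).div_const 2)).norm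
    (tendsto_const_nhds.div (hcont.norm.mul_const R)
      (mul_ne_zero (norm_ne_zero_iff.2 hb0) hR.ne')) ?_
  filter_upwards [self_mem_nhdsWithin] with δ hδ
  exact key _ (by simpa using add_pos_of_nonneg_of_pos hb hδ)

theorem tendsto_integral_cexp_neg_mul_sq {b : ℂ} (hb : 0 ≤ b.re) (hb0 : b ≠ 0) :
    Tendsto (fun R : ℝ => ∫ x in (0 : ℝ)..R, cexp (-b * (x : ℂ) ^ 2)) atTop
      (𝓝 ((π / b) ^ (1 / 2 : ℂ) / 2)) := by
  rw [tendsto_iff_norm_sub_tendsto_zero]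
  refine squeeze_zero' (Eventually.of_forall fun _ => norm_nonneg _) ?_
    (tendsto_const_nhds.div_atTop (tendsto_id.const_mul_atTop (norm_pos_iff.2 hb0)) :
      Tendsto (fun R : ℝ => 1 / (‖b‖ * R)) atTop (𝓝 0))
  filter_upwards [eventually_gt_atTop 0] with R hR
  exact norm_integral_cexp_neg_mul_sq_sub_le hb hb0 hR

theorem ofReal_mul_exp_cpow_half {x θ : ℝ} (hx : 0 < x) (hθ : -π < θ) (hθ' : θ ≤ π) :
    ((x : ℂ) * cexp (I * θ)) ^ (1 / 2 : ℂ) = (√x : ℂ) * cexp (I * ((θ / 2 : ℝ) : ℂ)) := by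
  have h : (x : ℂ) * cexp (I * θ) = cexp (((Real.log x : ℝ) : ℂ) + I * θ) := by
    rw [Complex.exp_add, ← ofReal_exp, Real.exp_log hx]
  have h2 : (√x : ℂ) = cexp ((Real.log x / 2 : ℝ) : ℂ) := by
    rw [← ofReal_exp, Real.exp_half, Real.exp_log hx]
  rw [h, cpow_def_of_ne_zero (Complex.exp_ne_zero _), log_exp (by simpa) (by simpa), h2,
    ← Complex.exp_add]
  congr 1
  push_cast
  ring

theorem tendsto_integral_cexp_I_mul_sq :
    Tendsto (fun R : ℝ => ∫ x in (0 : ℝ)..R, cexp (I * (x : ℂ) ^ 2)) atTop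
      (𝓝 ((√π / 2 : ℂ) * cexp (I * ((π / 4 : ℝ) : ℂ)))) := by
  have h := tendsto_integral_cexp_neg_mul_sq (b := -I) (by simp) (by simp)
  have h1 : (π : ℂ) / -I = (π : ℂ) * cexp (I * (π / 2 : ℝ)) := by
    rw [mul_comm I, ofReal_div, ofReal_ofNat, exp_pi_div_two_mul_I,
      div_eq_mul_inv, inv_neg, inv_I, neg_neg]
  rw [h1, ofReal_mul_exp_cpow_half Real.pi_pos (by linarith [Real.pi_pos])
    (by linarith [Real.pi_pos])] at h
  simp only [neg_neg] at h
  convert h using 2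
  ring_nf

theorem tendsto_integral_cexp_neg_I_mul_sq :
    Tendsto (fun R : ℝ => ∫ x in (0 : ℝ)..R, cexp (-I * (x : ℂ) ^ 2)) atTop
      (𝓝 ((√π / 2 : ℂ) * cexp (-I * ((π / 4 : ℝ) : ℂ)))) := by
  have h := tendsto_integral_cexp_neg_mul_sq (b := I) (by simp) (by simp)
  have h1 : (π : ℂ) / I = (π : ℂ) * cexp (I * (-(π / 2) : ℝ)) := by
    rw [mul_comm I, ofReal_neg, neg_mul, Complex.exp_neg, ofReal_div, ofReal_ofNat,
      exp_pi_div_two_mul_I, div_eq_mul_inv]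
  rw [h1, ofReal_mul_exp_cpow_half Real.pi_pos (by linarith [Real.pi_pos])
    (by linarith [Real.pi_pos])] at h
  convert h using 2
  push_cast
  ring_nf

/-- A `C¹` function vanishing at `0` and `π` is dominated by the sine on `[0, π]`. -/
theorem exists_norm_le_mul_sin {f : ℝ → ℂ} (hf : ContDiff ℝ 1 f) (h0 : f 0 = 0) (hπ : f π = 0) :
    ∃ M, 0 ≤ M ∧ ∀ x ∈ Set.Icc 0 π, ‖f x‖ ≤ M * Real.sin x ∧ ‖deriv f x‖ ≤ M := by
  obtain ⟨K, hK⟩ := (isCompact_Icc (a := (0 : ℝ)) (b := π)).exists_bound_of_continuousOn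
    (hf.continuous_deriv le_rfl).continuousOn
  have hpi := Real.pi_pos
  have hK0 : 0 ≤ K := (norm_nonneg _).trans (hK 0 ⟨le_rfl, hpi.le⟩)
  have mvt : ∀ x ∈ Set.Icc 0 π, ∀ y ∈ Set.Icc 0 π, ‖f y - f x‖ ≤ K * ‖y - x‖ := fun x hx y hy =>
    (convex_Icc 0 π).norm_image_sub_le_of_norm_deriv_le
      (fun z _ => hf.differentiable one_ne_zero z) hK hx hy
  have hle : K ≤ K * (π / 2) := le_mul_of_one_le_right hK0 (by linarith [Real.pi_gt_three])
  have aux : ∀ y s : ℝ, 2 / π * y ≤ s → K * y ≤ K * (π / 2) * s := fun y s h => by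
    have := mul_le_mul_of_nonneg_left h (mul_nonneg hK0 (by positivity : 0 ≤ π / 2))
    calc K * y = K * (π / 2) * (2 / π * y) := by field_simp
      _ ≤ _ := this
  refine ⟨K * (π / 2), by positivity, fun x hx => ⟨?_, (hK x hx).trans hle⟩⟩
  rcases le_total x (π / 2) with h | h
  · have := mvt 0 ⟨le_rfl, hpi.le⟩ x hx
    rw [h0, sub_zero, sub_zero, Real.norm_of_nonneg hx.1] at this
    exact this.trans (aux _ _ (Real.mul_le_sin hx.1 h))
  · have := mvt π ⟨hpi.le, le_rfl⟩ x hx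
    rw [hπ, sub_zero, norm_sub_rev, Real.norm_of_nonneg (sub_nonneg.2 hx.2)] at this
    have hs := Real.mul_le_sin (sub_nonneg.2 hx.2) (by linarith)
    rw [Real.sin_pi_sub] at hs
    exact this.trans (aux _ _ hs)

theorem two_div_pi_mul_le_sin {ε x : ℝ} (hε : 0 ≤ ε) (hx : x ∈ Set.Icc ε (π - ε)) :
    2 / π * ε ≤ Real.sin x := by
  have hpi := Real.pi_pos
  rcases le_total x (π / 2) with h | h
  · exact (mul_le_mul_of_nonneg_left hx.1 (by positivity)).trans
      (Real.mul_le_sin (hε.trans hx.1) h)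
  · rw [← Real.sin_pi_sub]
    exact (mul_le_mul_of_nonneg_left (by linarith [hx.2]) (by positivity)).trans
      (Real.mul_le_sin (by linarith [hx.2]) (by linarith))

section Phase

variable {φ ρ : ℝ → ℝ}

/-- Away from the critical points `0` and `π` of the phase, one integration by parts gains `1 / t`. -/
theorem norm_integral_mid_le {q : ℝ → ℂ} (hφ : ∀ x, HasDerivAt φ (ρ x * Real.sin x) x)
    (hρ : Continuous ρ) (hq : ContDiff ℝ 1 q) {M : ℝ} (hM : 0 ≤ M)
    (hqM : ∀ x ∈ Set.Icc 0 π, ‖q x‖ ≤ M * Real.sin x ∧ ‖deriv q x‖ ≤ M)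
    {t ε : ℝ} (ht : 0 < t) (hε : 0 < ε) (hεπ : ε ≤ π / 2) :
    ‖∫ x in ε..(π - ε), q x * (ρ x : ℂ) * cexp (I * t * (φ x : ℂ))‖
      ≤ M * (π + π ^ 2) / (t * ε) := by
  have hpi := Real.pi_pos
  have hle : ε ≤ π - ε := by linarith
  have hmem : ∀ x ∈ Set.uIcc ε (π - ε), x ∈ Set.Icc ε (π - ε) := fun x hx => by
    rwa [Set.uIcc_of_le hle] at hx
  have hmem' : ∀ x ∈ Set.Icc ε (π - ε), x ∈ Set.Icc 0 π := fun x hx =>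
    ⟨hε.le.trans hx.1, hx.2.trans (by linarith)⟩
  have hsin : ∀ x ∈ Set.Icc ε (π - ε), 0 < Real.sin x := fun x hx =>
    lt_of_lt_of_le (by positivity) (two_div_pi_mul_le_sin hε.le hx)
  have hne : ∀ x ∈ Set.Icc ε (π - ε), (Real.sin x : ℂ) ≠ 0 := fun x hx =>
    ofReal_ne_zero.2 (hsin x hx).ne'
  have hφc : Continuous φ := continuous_iff_continuousAt.2 fun x => (hφ x).continuousAt
  have hqc := hq.continuous
  have hqc' := hq.continuous_deriv le_rfl
  set r' : ℝ → ℂ := fun x =>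
    (deriv q x * Real.sin x - q x * Real.cos x) / (Real.sin x : ℂ) ^ 2 with hr'
  have hr : ∀ x ∈ Set.uIcc ε (π - ε), HasDerivAt (fun y => q y / (Real.sin y : ℂ)) (r' x) x :=
    fun x hx => (hq.differentiable one_ne_zero x).hasDerivAt.div
      (Real.hasDerivAt_sin x).ofReal_comp (hne x (hmem x hx))
  have hr'c : ContinuousOn r' (Set.uIcc ε (π - ε)) :=
    ContinuousOn.div (by fun_prop) (by fun_prop) fun x hx => pow_ne_zero 2 (hne x (hmem x hx))
  have hE : ∀ x, HasDerivAt (fun y => cexp (I * t * (φ y : ℂ)))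
      (cexp (I * t * (φ x : ℂ)) * (I * t * ((ρ x * Real.sin x : ℝ) : ℂ))) x := fun x =>
    ((hφ x).ofReal_comp.const_mul (I * (t : ℂ))).cexp
  have hparts := intervalIntegral.integral_mul_deriv_eq_deriv_mul hr (fun x _ => hE x)
    hr'c.intervalIntegrable (Continuous.intervalIntegrable (by fun_prop) _ _)
  have hlhs : ∫ x in ε..(π - ε), q x / (Real.sin x : ℂ) *
        (cexp (I * t * (φ x : ℂ)) * (I * t * ((ρ x * Real.sin x : ℝ) : ℂ))) =
      I * t * ∫ x in ε..(π - ε), q x * (ρ x : ℂ) * cexp (I * t * (φ x : ℂ)) := by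
    rw [← intervalIntegral.integral_const_mul]
    refine intervalIntegral.integral_congr fun x hx => ?_
    have := hne x (hmem x hx)
    push_cast at this ⊢
    field_simp
  have hexp : ∀ x, ‖cexp (I * t * (φ x : ℂ))‖ = 1 := fun x => by
    rw [mul_assoc, ← ofReal_mul, mul_comm, norm_exp_ofReal_mul_I]
  have hbd : ∀ x ∈ Set.Icc ε (π - ε),
      ‖q x / (Real.sin x : ℂ) * cexp (I * t * (φ x : ℂ))‖ ≤ M := fun x hx => by
    rw [norm_mul, hexp, mul_one, norm_div, norm_real, Real.norm_of_nonneg (hsin x hx).le,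
      div_le_iff₀ (hsin x hx)]
    exact (hqM x (hmem' x hx)).1
  have hr'M : ∀ x ∈ Set.Icc ε (π - ε), ‖r' x‖ ≤ M * π / ε := fun x hx => by
    have hs := hsin x hx
    have hnum : ‖deriv q x * Real.sin x - q x * Real.cos x‖ ≤ 2 * M * Real.sin x := by
      refine (norm_sub_le _ _).trans ?_
      rw [norm_mul, norm_mul, norm_real, norm_real, Real.norm_of_nonneg hs.le]
      have h1 := mul_le_mul_of_nonneg_right (hqM x (hmem' x hx)).2 hs.le
      have h2 : ‖q x‖ * ‖Real.cos x‖ ≤ ‖q x‖ :=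
        mul_le_of_le_one_right (norm_nonneg _) (Real.abs_cos_le_one x)
      linarith [(hqM x (hmem' x hx)).1]
    rw [hr', norm_div, norm_pow, norm_real, Real.norm_of_nonneg hs.le, div_le_div_iff₀
      (by positivity) hε]
    have h3 := two_div_pi_mul_le_sin hε.le hx
    have h4 : 2 * ε ≤ π * Real.sin x := by
      calc 2 * ε = π * (2 / π * ε) := by field_simp
        _ ≤ _ := by gcongr
    calc _ ≤ 2 * M * Real.sin x * ε := by gcongr
      _ = M * Real.sin x * (2 * ε) := by ring
      _ ≤ M * Real.sin x * (π * Real.sin x) := by gcongr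
      _ = _ := by ring
  have hrem : ‖∫ x in ε..(π - ε), r' x * cexp (I * t * (φ x : ℂ))‖ ≤ M * π / ε * π := by
    refine (intervalIntegral.norm_integral_le_of_norm_le_const (C := M * π / ε)
      fun x hx => ?_).trans ?_
    · rw [norm_mul, hexp, mul_one]
      exact hr'M x (hmem x (Set.uIoc_subset_uIcc hx))
    · rw [abs_of_nonneg (by linarith)]
      gcongr
      linarith
  have htot : ‖I * t * ∫ x in ε..(π - ε), q x * (ρ x : ℂ) * cexp (I * t * (φ x : ℂ))‖ ≤
      2 * M + M * π / ε * π := by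
    rw [← hlhs, hparts]
    refine (norm_sub_le _ _).trans (add_le_add ((norm_sub_le _ _).trans ?_) hrem)
    linarith [hbd _ (Set.right_mem_Icc.2 hle), hbd _ (Set.left_mem_Icc.2 hle)]
  rw [norm_mul, norm_mul, norm_I, one_mul, norm_real, Real.norm_of_nonneg ht.le] at htot
  rw [le_div_iff₀ (by positivity)]
  calc _ = t * ‖∫ x in ε..(π - ε), q x * (ρ x : ℂ) * cexp (I * t * (φ x : ℂ))‖ * ε := by ring
    _ ≤ (2 * M + M * π / ε * π) * ε := by gcongr
    _ = M * (2 * ε + π ^ 2) := by field_simp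
    _ ≤ _ := by gcongr; linarith

theorem norm_integral_le_of_vanishing {f : ℝ → ℂ} (hφ : Continuous φ) (hf : Continuous f) {M : ℝ}
    (hM : 0 ≤ M) (hfM : ∀ x ∈ Set.Icc 0 π, ‖f x‖ ≤ M * Real.sin x) {t ε B : ℝ}
    (hε : 0 < ε) (hεπ : ε ≤ π / 2)
    (hB : ‖∫ x in ε..(π - ε), f x * cexp (I * t * (φ x : ℂ))‖ ≤ B) :
    ‖∫ x in (0 : ℝ)..π, f x * cexp (I * t * (φ x : ℂ))‖ ≤ 2 * M * ε ^ 2 + B := by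
  have hint : ∀ a b, IntervalIntegrable (fun x => f x * cexp (I * t * (φ x : ℂ))) volume a b :=
    fun a b => Continuous.intervalIntegrable (by fun_prop) _ _
  have hexp : ∀ x, ‖cexp (I * t * (φ x : ℂ))‖ = 1 := fun x => by
    rw [mul_assoc, ← ofReal_mul, mul_comm, norm_exp_ofReal_mul_I]
  have h1 : ‖∫ x in (0 : ℝ)..ε, f x * cexp (I * t * (φ x : ℂ))‖ ≤ M * ε * |ε - 0| := by
    refine intervalIntegral.norm_integral_le_of_norm_le_const fun x hx => ?_
    rw [Set.uIoc_of_le hε.le] at hx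
    rw [norm_mul, hexp, mul_one]
    refine (hfM x ⟨hx.1.le, by linarith [hx.2]⟩).trans ?_
    gcongr
    exact (Real.sin_le hx.1.le).trans hx.2
  have h2 : ‖∫ x in (π - ε)..π, f x * cexp (I * t * (φ x : ℂ))‖ ≤ M * ε * |π - (π - ε)| := by
    refine intervalIntegral.norm_integral_le_of_norm_le_const fun x hx => ?_
    rw [Set.uIoc_of_le (by linarith)] at hx
    rw [norm_mul, hexp, mul_one]
    refine (hfM x ⟨by linarith [hx.1], hx.2⟩).trans ?_
    gcongr
    rw [← Real.sin_pi_sub]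
    exact (Real.sin_le (by linarith [hx.2])).trans (by linarith [hx.1])
  rw [sub_zero, abs_of_pos hε] at h1
  rw [sub_sub_cancel, abs_of_pos hε] at h2
  rw [← intervalIntegral.integral_add_adjacent_intervals (hint 0 (π - ε)) (hint (π - ε) π),
    ← intervalIntegral.integral_add_adjacent_intervals (hint 0 ε) (hint ε (π - ε))]
  refine (norm_add₃_le).trans ?_
  linarith

/-- An amplitude vanishing at both critical points contributes `o(1 / √t)`. -/
theorem tendsto_sqrt_mul_integral_of_vanishing (hφ : ∀ x, HasDerivAt φ (ρ x * Real.sin x) x)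
    (hρ : ContDiff ℝ 1 ρ) (hρ0 : ∀ x, ρ x ≠ 0) {f : ℝ → ℂ} (hf : ContDiff ℝ 1 f)
    (h0 : f 0 = 0) (hπ : f π = 0) :
    Tendsto (fun t : ℝ => (√t : ℂ) * ∫ x in (0 : ℝ)..π, f x * cexp (I * t * (φ x : ℂ)))
      atTop (𝓝 0) := by
  have hφc : Continuous φ := continuous_iff_continuousAt.2 fun x => (hφ x).continuousAt
  have hρ' : ∀ x, (ρ x : ℂ) ≠ 0 := fun x => ofReal_ne_zero.2 (hρ0 x)
  obtain ⟨M, hM, hfM⟩ := exists_norm_le_mul_sin hf h0 hπ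
  have hq : ContDiff ℝ 1 fun x => f x / (ρ x : ℂ) := by
    simpa only [div_eq_mul_inv] using! hf.mul ((ofRealCLM.contDiff.comp hρ).inv hρ')
  obtain ⟨N, hN, hqN⟩ := exists_norm_le_mul_sin hq (by simp [h0]) (by simp [hπ])
  have hlim : Tendsto (fun t : ℝ => (2 * M + N * (π + π ^ 2)) * t ^ (-(1 / 6) : ℝ)) atTop (𝓝 0) := by
    simpa using (tendsto_rpow_neg_atTop (by norm_num : (0 : ℝ) < 1 / 6)).const_mul
      (2 * M + N * (π + π ^ 2))
  have hsmall : ∀ᶠ t : ℝ in atTop, t ^ (-(1 / 3) : ℝ) ≤ π / 2 :=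
    (tendsto_rpow_neg_atTop (by norm_num : (0 : ℝ) < 1 / 3)).eventually_le_const (by positivity)
  refine squeeze_zero_norm' ?_ hlim
  filter_upwards [eventually_gt_atTop 0, hsmall] with t ht hεπ
  obtain ⟨ε, hεt⟩ : ∃ ε, ε = t ^ (-(1 / 3) : ℝ) := ⟨_, rfl⟩
  rw [← hεt] at hεπ
  have hε : 0 < ε := hεt ▸ Real.rpow_pos_of_pos ht _
  have hmid := norm_integral_mid_le hφ hρ.continuous hq hN hqN ht hε hεπ
  simp only [div_mul_cancel₀ _ (hρ' _)] at hmid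
  have hall := norm_integral_le_of_vanishing hφc hf.continuous hM (fun x hx => (hfM x hx).1)
    hε hεπ hmid
  rw [norm_mul, norm_real, Real.norm_of_nonneg (Real.sqrt_nonneg t)]
  refine (mul_le_mul_of_nonneg_left hall (Real.sqrt_nonneg t)).trans_eq ?_
  have e1 : √t * ε ^ 2 = t ^ (-(1 / 6) : ℝ) := by
    rw [hεt, Real.sqrt_eq_rpow, ← Real.rpow_natCast, ← Real.rpow_mul ht.le, ← Real.rpow_add ht]
    norm_num
  have e2 : √t * (t * ε)⁻¹ = t ^ (-(1 / 6) : ℝ) := by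
    rw [hεt, Real.sqrt_eq_rpow, ← Real.rpow_one_add' ht.le (by norm_num), ← Real.rpow_neg ht.le,
      ← Real.rpow_add ht]
    norm_num
  rw [div_eq_mul_inv]
  linear_combination (2 * M) * e1 + (N * (π + π ^ 2)) * e2

end Phase

/-- The quadratic substitution turns a phase `c + σ u²` into a Fresnel integral. -/
theorem sqrt_mul_integral_deriv_mul_cexp {u : ℝ → ℝ} (hu : ContDiff ℝ 1 u) (c : ℝ) (σ : ℂ) (a b : ℝ)
    {t : ℝ} (ht : 0 ≤ t) :
    (√t : ℂ) * ∫ x in a..b, ((deriv u x : ℝ) : ℂ) * cexp (I * t * (c + σ * (u x : ℂ) ^ 2)) =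
      cexp (I * t * c) * ∫ w in (√t * u a)..(√t * u b), cexp (I * σ * (w : ℂ) ^ 2) := by
  have hu' := hu.continuous_deriv le_rfl
  have hd : ∀ x ∈ Set.uIcc a b, HasDerivAt (fun y => √t * u y) (√t * deriv u x) x := fun x _ =>
    (hu.differentiable one_ne_zero x).hasDerivAt.const_mul _
  rw [← intervalIntegral.integral_deriv_smul_comp hd (by fun_prop)
    (g := fun w : ℝ => cexp (I * σ * (w : ℂ) ^ 2)) (by fun_prop),
    ← intervalIntegral.integral_const_mul, ← intervalIntegral.integral_const_mul]
  refine intervalIntegral.integral_congr fun x _ => ?_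
  have hs : (√t : ℂ) ^ 2 = t := by rw [← ofReal_pow, Real.sq_sqrt ht]
  simp only [Function.comp_apply, real_smul, ofReal_mul, mul_pow, hs]
  rw [mul_left_comm (cexp _), ← Complex.exp_add, mul_assoc]
  ring_nf

theorem tendsto_zero_cexp_mul {c : ℝ} {F : ℝ → ℂ} {L : ℂ} (A : ℂ) (hF : Tendsto F atTop (𝓝 L))
    {κ : ℝ} (hκ : 0 < κ) :
    Tendsto (fun t : ℝ => A * (cexp (I * t * c) * (F (√t * κ) - L))) atTop (𝓝 0) := by
  have h := (hF.comp (Real.tendsto_sqrt_atTop.atTop_mul_const hκ)).sub_const L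
  rw [sub_self] at h
  have h2 : Tendsto (fun t : ℝ => cexp (I * t * c) * (F (√t * κ) - L)) atTop (𝓝 0) := by
    refine squeeze_zero_norm (fun t => ?_) (tendsto_zero_iff_norm_tendsto_zero.1 h)
    rw [norm_mul, mul_assoc, ← ofReal_mul, mul_comm I, norm_exp_ofReal_mul_I, one_mul]
    rfl
  simpa using h2.const_mul A

/-- Stationary phase on `[0, π]` for a phase increasing from a nondegenerate minimum at `0` to a
nondegenerate maximum at `π`; the functions `u` and `v` put it in normal form at the two ends. -/
theorem tendsto_sqrt_mul_integral_sub {φ ρ u v : ℝ → ℝ} {c d α β : ℝ}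
    (hφ : ∀ x, HasDerivAt φ (ρ x * Real.sin x) x) (hρ : ContDiff ℝ 1 ρ) (hρ0 : ∀ x, ρ x ≠ 0)
    (hu : ContDiff ℝ 2 u) (hv : ContDiff ℝ 2 v)
    (hφu : ∀ x, φ x = c + u x ^ 2) (hφv : ∀ x, φ x = d - v x ^ 2)
    (hu0 : u 0 = 0) (huπ : 0 < u π) (hv0 : 0 < v 0) (hvπ : v π = 0)
    (hu' : deriv u 0 = α) (hv' : deriv v π = -β) (hα : α ≠ 0) (hβ : β ≠ 0)
    {G : ℝ → ℂ} (hG : ContDiff ℝ 1 G) :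
    Tendsto (fun t : ℝ => (√t : ℂ) * (∫ x in (0 : ℝ)..π, G x * cexp (I * t * (φ x : ℂ))) -
        (G 0 / α * (cexp (I * t * c) * ((√π / 2 : ℂ) * cexp (I * ((π / 4 : ℝ) : ℂ)))) +
          G π / β * (cexp (I * t * d) * ((√π / 2 : ℂ) * cexp (-I * ((π / 4 : ℝ) : ℂ))))))
      atTop (𝓝 0) := by
  have hdu : ContDiff ℝ 1 (deriv u) := hu.deriv'
  have hdv : ContDiff ℝ 1 (deriv v) := hv.deriv'
  have hu1 : ContDiff ℝ 1 u := hu.of_le one_le_two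
  have hv1 : ContDiff ℝ 1 v := hv.of_le one_le_two
  have hφc : Continuous φ := continuous_iff_continuousAt.2 fun x => (hφ x).continuousAt
  have huπ' : deriv u π = 0 := by
    have h := (((hu1.differentiable one_ne_zero π).hasDerivAt.pow 2).const_add c).congr_of_eventuallyEq
      (Eventually.of_forall hφu)
    simpa [huπ.ne'] using h.unique (hφ π)
  have hv0' : deriv v 0 = 0 := by
    have h := (((hv1.differentiable one_ne_zero 0).hasDerivAt.pow 2).const_sub d).congr_of_eventuallyEq
      (Eventually.of_forall hφv)
    simpa [hv0.ne'] using h.unique (hφ 0)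
  have hα' : (α : ℂ) ≠ 0 := ofReal_ne_zero.2 hα
  have hβ' : (β : ℂ) ≠ 0 := ofReal_ne_zero.2 hβ
  set f : ℝ → ℂ := fun x =>
    G x - G 0 / α * ((deriv u x : ℝ) : ℂ) + G π / β * ((deriv v x : ℝ) : ℂ) with hf
  have hfC : ContDiff ℝ 1 f :=
    (hG.sub (contDiff_const.mul (ofRealCLM.contDiff.comp hdu))).add
      (contDiff_const.mul (ofRealCLM.contDiff.comp hdv))
  have hrem := tendsto_sqrt_mul_integral_of_vanishing hφ hρ hρ0 hfC
    (by simp [hf, hu', hv0', hα']) (by simp [hf, huπ', hv', hβ'])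
  have hsum := (hrem.add (tendsto_zero_cexp_mul (c := c) (G 0 / α)
    tendsto_integral_cexp_I_mul_sq huπ)).add
    (tendsto_zero_cexp_mul (c := d) (G π / β) tendsto_integral_cexp_neg_I_mul_sq hv0)
  simp only [add_zero] at hsum
  refine hsum.congr' ?_
  filter_upwards [eventually_ge_atTop 0] with t ht
  have cdu := hdu.continuous
  have cdv := hdv.continuous
  have cG := hG.continuous
  have eu : (√t : ℂ) * ∫ x in (0 : ℝ)..π, ((deriv u x : ℝ) : ℂ) * cexp (I * t * (φ x : ℂ)) =
      cexp (I * t * c) * ∫ w in (0 : ℝ)..(√t * u π), cexp (I * (w : ℂ) ^ 2) := by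
    simpa [hφu, hu0] using sqrt_mul_integral_deriv_mul_cexp hu1 c 1 0 π ht
  have ev : (√t : ℂ) * ∫ x in (0 : ℝ)..π, ((deriv v x : ℝ) : ℂ) * cexp (I * t * (φ x : ℂ)) =
      -(cexp (I * t * d) * ∫ w in (0 : ℝ)..(√t * v 0), cexp (-I * (w : ℂ) ^ 2)) := by
    rw [← mul_neg, ← intervalIntegral.integral_symm]
    simpa [hφv, hvπ, ← sub_eq_add_neg] using sqrt_mul_integral_deriv_mul_cexp hv1 d (-1) 0 π ht
  have split : ∫ x in (0 : ℝ)..π, f x * cexp (I * t * (φ x : ℂ)) =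
      (∫ x in (0 : ℝ)..π, G x * cexp (I * t * (φ x : ℂ))) -
        G 0 / α * (∫ x in (0 : ℝ)..π, ((deriv u x : ℝ) : ℂ) * cexp (I * t * (φ x : ℂ))) +
        G π / β * ∫ x in (0 : ℝ)..π, ((deriv v x : ℝ) : ℂ) * cexp (I * t * (φ x : ℂ)) := by
    rw [← intervalIntegral.integral_const_mul, ← intervalIntegral.integral_const_mul,
      ← intervalIntegral.integral_sub (Continuous.intervalIntegrable (by fun_prop) _ _)
        (Continuous.intervalIntegrable (by fun_prop) _ _),
      ← intervalIntegral.integral_add (Continuous.intervalIntegrable (by fun_prop) _ _)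
        (Continuous.intervalIntegrable (by fun_prop) _ _)]
    refine intervalIntegral.integral_congr fun x _ => ?_
    simp only [hf]
    ring
  rw [split]
  linear_combination (-(G 0 / α)) * eu + (G π / β) * ev

theorem integral_eq_integral_add_reflect {F : ℝ → ℂ} (hF : Continuous F) :
    ∫ x in (0 : ℝ)..(2 * π), F x = ∫ x in (0 : ℝ)..π, (F x + F (2 * π - x)) := by
  rw [intervalIntegral.integral_add (hF.intervalIntegrable _ _)
    (Continuous.intervalIntegrable (by fun_prop) _ _), intervalIntegral.integral_comp_sub_left,
    show 2 * π - π = π by ring, sub_zero,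
    intervalIntegral.integral_add_adjacent_intervals (hF.intervalIntegrable _ _)
      (hF.intervalIntegrable _ _)]


/-- Stationary-phase asymptotics of `E[g](t)` for `ω₀ > 0`:
`√t·E[g](t)` approaches the two-oscillator leading term as `t → ∞`. -/
theorem stationary_phase_E (ω₀ ω₁ : ℝ) (hω₀ : 0 < ω₀) (hω₁ : 0 < ω₁)
    (ω : ℝ → ℝ) (hω : ∀ l : ℝ, ω l = Real.sqrt (ω₀ ^ 2 + 2 * ω₁ ^ 2 * (1 - Real.cos l)))
    (ω₀' : ℝ) (hω₀' : ω₀' = Real.sqrt (ω₀ ^ 2 + 4 * ω₁ ^ 2))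
    (g : ℝ → ℂ) (hg : ContDiff ℝ 2 g) (hgper : Function.Periodic g (2 * π))
    (c₁ c₂ : ℝ) (hc₁ : c₁ = (1 / ω₁) * Real.sqrt (ω₀ / (2 * π)))
    (hc₂ : c₂ = (1 / ω₁) * Real.sqrt (ω₀' / (2 * π))) :
    Tendsto (fun t : ℝ =>
        (Real.sqrt t : ℂ) *
            ((1 / (2 * (π : ℂ))) * ∫ l in (0:ℝ)..(2 * π),
              g l * Complex.exp (Complex.I * (t : ℂ) * (ω l : ℂ))) -
          ((c₁ : ℂ) * g 0 * Complex.exp (Complex.I * ((t * ω₀ + π / 4 : ℝ) : ℂ)) +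
            (c₂ : ℂ) * g π * Complex.exp (Complex.I * ((t * ω₀' - π / 4 : ℝ) : ℂ))))
      atTop (nhds 0) := by
  have hpi := Real.pi_pos
  have hcos : ∀ l, 0 ≤ 1 - Real.cos l := fun l => by linarith [Real.cos_le_one l]
  have hrad : ∀ l, 0 < ω₀ ^ 2 + 2 * ω₁ ^ 2 * (1 - Real.cos l) := fun l => by
    have := hcos l; positivity
  have hωpos : ∀ l, 0 < ω l := fun l => by rw [hω]; exact Real.sqrt_pos.2 (hrad l)
  have hωsq : ∀ l, ω l ^ 2 = ω₀ ^ 2 + 2 * ω₁ ^ 2 * (1 - Real.cos l) := fun l => by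
    rw [hω, Real.sq_sqrt (hrad l).le]
  have hω₀'pos : 0 < ω₀' := by rw [hω₀']; positivity
  have hω₀'sq : ω₀' ^ 2 = ω₀ ^ 2 + 4 * ω₁ ^ 2 := by rw [hω₀', Real.sq_sqrt (by positivity)]
  have hω0 : ω 0 = ω₀ := by rw [hω]; simp [Real.sqrt_sq hω₀.le]
  have hωπ : ω π = ω₀' := by rw [hω, hω₀', Real.cos_pi]; ring_nf
  have hωC : ContDiff ℝ 2 ω := by
    rw [funext hω]
    exact ContDiff.sqrt (by fun_prop) fun l => (hrad l).ne'
  have hcosHalf : ∀ l, Real.cos l = 1 - 2 * Real.sin (l / 2) ^ 2 := fun l => by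
    have := Real.cos_two_mul (l / 2)
    rw [mul_div_cancel₀ l (two_ne_zero' ℝ), Real.cos_sq'] at this
    linarith
  -- the normal form coordinates at the minimum and at the maximum of the dispersion relation
  set u : ℝ → ℝ := fun l => 2 * ω₁ * Real.sin (l / 2) * (√(ω l + ω₀))⁻¹ with hu
  set v : ℝ → ℝ := fun l => 2 * ω₁ * Real.cos (l / 2) * (√(ω₀' + ω l))⁻¹ with hv
  have hpu : ∀ l, 0 < ω l + ω₀ := fun l => by linarith [hωpos l]
  have hpv : ∀ l, 0 < ω₀' + ω l := fun l => by linarith [hωpos l]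
  have hkuC : ContDiff ℝ 2 fun l => (√(ω l + ω₀))⁻¹ :=
    ((hωC.add contDiff_const).sqrt fun l => (hpu l).ne').inv fun l => (Real.sqrt_pos.2 (hpu l)).ne'
  have hkvC : ContDiff ℝ 2 fun l => (√(ω₀' + ω l))⁻¹ :=
    ((contDiff_const.add hωC).sqrt fun l => (hpv l).ne').inv fun l => (Real.sqrt_pos.2 (hpv l)).ne'
  have huC : ContDiff ℝ 2 u := ContDiff.mul (by fun_prop) hkuC
  have hvC : ContDiff ℝ 2 v := ContDiff.mul (by fun_prop) hkvC
  have hφu : ∀ l, ω l = ω₀ + u l ^ 2 := fun l => by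
    have h := hpu l
    have h2 := hωsq l
    rw [hcosHalf] at h2
    simp only [hu, mul_pow, inv_pow, Real.sq_sqrt h.le]
    field_simp
    linear_combination h2
  have hφv : ∀ l, ω l = ω₀' - v l ^ 2 := fun l => by
    have h := hpv l
    have h2 := hωsq l
    rw [hcosHalf] at h2
    simp only [hv, mul_pow, inv_pow, Real.sq_sqrt h.le, Real.cos_sq']
    field_simp
    linear_combination h2 - hω₀'sq
  have hφ : ∀ l, HasDerivAt ω (ω₁ ^ 2 / ω l * Real.sin l) l := fun l => by
    have h := ((((Real.hasDerivAt_cos l).const_sub 1).const_mul (2 * ω₁ ^ 2)).const_add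
      (ω₀ ^ 2)).sqrt (hrad l).ne'
    rw [← funext hω, ← hω] at h
    convert h using 1
    have := (hωpos l).ne'
    field_simp
  have hρC : ContDiff ℝ 1 fun l => ω₁ ^ 2 / ω l :=
    contDiff_const.div (hωC.of_le one_le_two) fun l => (hωpos l).ne'
  have hu' : deriv u 0 = ω₁ * (√(ω₀ + ω₀))⁻¹ := by
    have h1 : HasDerivAt (fun l : ℝ => 2 * ω₁ * Real.sin (l / 2)) ω₁ 0 := by
      have h := (((hasDerivAt_id (0 : ℝ)).div_const 2).sin).const_mul (2 * ω₁)
      convert! h using 1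
      simp
      ring
    have h2 := h1.mul (hkuC.differentiable two_ne_zero 0).hasDerivAt
    rw [show u = (fun l : ℝ => 2 * ω₁ * Real.sin (l / 2)) * fun l => (√(ω l + ω₀))⁻¹ from rfl,
      h2.deriv]
    simp [hω0]
  have hv' : deriv v π = -(ω₁ * (√(ω₀' + ω₀'))⁻¹) := by
    have h1 : HasDerivAt (fun l : ℝ => 2 * ω₁ * Real.cos (l / 2)) (-ω₁) π := by
      have h := (((hasDerivAt_id π).div_const 2).cos).const_mul (2 * ω₁)
      convert! h using 1
      simp
      ring
    have h2 := h1.mul (hkvC.differentiable two_ne_zero π).hasDerivAt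
    rw [show v = (fun l : ℝ => 2 * ω₁ * Real.cos (l / 2)) * fun l => (√(ω₀' + ω l))⁻¹ from rfl,
      h2.deriv]
    simp [hωπ]
  have hα : ω₁ * (√(ω₀ + ω₀))⁻¹ ≠ 0 := by positivity
  have hβ : ω₁ * (√(ω₀' + ω₀'))⁻¹ ≠ 0 := by positivity
  have hgC : ContDiff ℝ 1 g := hg.of_le one_le_two
  have hGC : ContDiff ℝ 1 fun l => g l + g (2 * π - l) := hgC.add (hgC.comp (by fun_prop))
  have hmain := (tendsto_sqrt_mul_integral_sub hφ hρC
    (fun l => (div_pos (pow_pos hω₁ 2) (hωpos l)).ne') huC hvC hφu hφv (by simp [hu])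
    (by have := Real.sqrt_pos.2 (hpu π); simp only [hu, Real.sin_pi_div_two]; positivity)
    (by have := Real.sqrt_pos.2 (hpv 0); simp only [hv, zero_div, Real.cos_zero]; positivity)
    (by simp [hv]) hu' hv' hα hβ hGC).const_mul (1 / (2 * (π : ℂ)))
  rw [mul_zero] at hmain
  refine hmain.congr fun t => ?_
  have hωc := hωC.continuous
  have hgc := hg.continuous
  have hωrefl : ∀ l, ω (2 * π - l) = ω l := fun l => by
    rw [hω, hω, Real.cos_two_pi_sub]
  have hconst : ∀ w : ℝ, 0 < w →
      (1 / (2 * (π : ℂ))) * (2 / ((ω₁ * (√(w + w))⁻¹ : ℝ) : ℂ)) * (√π / 2) =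
        ((1 / ω₁ * √(w / (2 * π)) : ℝ) : ℂ) := fun w hw => by
    have hr : 1 / (2 * π) * (2 / (ω₁ * (√(w + w))⁻¹)) * (√π / 2) = 1 / ω₁ * √(w / (2 * π)) := by
      have h : √(w / (2 * π)) = √(w + w) * √π / (2 * π) := by
        rw [← Real.sqrt_mul (by positivity), eq_div_iff (by positivity)]
        rw [← Real.sqrt_sq (by positivity : 0 ≤ 2 * π), ← Real.sqrt_mul (by positivity),
          Real.sqrt_sq (by positivity : 0 ≤ 2 * π)]
        congr 1
        field_simp
        ring
      rw [h]
      have := (Real.sqrt_pos.2 (add_pos hw hw)).ne'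
      field_simp
    rw [← hr]
    push_cast
    ring
  have e1 := hconst ω₀ hω₀
  have e2 := hconst ω₀' hω₀'pos
  rw [← hc₁] at e1
  rw [← hc₂] at e2
  have g0 : g (2 * π - 0) = g 0 := by rw [sub_zero]; simpa using hgper 0
  have gπ : g (2 * π - π) = g π := by congr 1; ring
  rw [integral_eq_integral_add_reflect (by fun_prop)]
  simp only [hωrefl, ← add_mul, g0, gπ]
  have x1 : cexp (I * ((t * ω₀ + π / 4 : ℝ) : ℂ)) =
      cexp (I * t * ω₀) * cexp (I * ((π / 4 : ℝ) : ℂ)) := by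
    rw [← Complex.exp_add]; push_cast; ring_nf
  have x2 : cexp (I * ((t * ω₀' - π / 4 : ℝ) : ℂ)) =
      cexp (I * t * ω₀') * cexp (-I * ((π / 4 : ℝ) : ℂ)) := by
    rw [← Complex.exp_add]; push_cast; ring_nf
  rw [x1, x2, ← e1, ← e2]
  ring
end

section
/- Fix ω₀ ≥ 0, ω₁ > 0, β > 0, set ω(λ) = √(ω₀² + 2ω₁²(1 − cos λ)) and γ(β) = β²ω₁² − 1 − βω₀, and assume γ(β) > 0. Let g : ℝ → ℂ be a twice continuously differentiable 2π-periodic function and define F[g](β, k) = (1/2π)·∫₀^{2π} g(λ)·e^{i·k·(λ + β·ω(λ))} dλ for k ∈ ℤ. Set Δ = √((β²ω₁² − 1)² − β²ω₀²), μ_± = −arccos( (1 ± Δ)/(β²ω₁²) ), c_± = √( β·ω(μ_±) / (2πΔ) ), and ω_±(k) = k·(μ_± + β·ω(μ_±)) ± (π/4)·sign(k). Then lim_{|k|→∞, k∈ℤ} [ √|k|·F[g](β, k) − ( c₊·g(μ₊)·e^{i·ω₊(k)} + c₋·g(μ₋)·e^{i·ω₋(k)} ) ] = 0. -/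
open scoped Real
open MeasureTheory Complex Filter

/-- Van der Corput type bound away from a critical point at the origin. -/
theorem norm_integral_mul_exp_phase_le {g g' : ℝ → ℂ} {φ φ₁ φ₂ : ℝ → ℝ} {ε R t m M : ℝ}
    (hg : ∀ x, HasDerivAt g (g' x) x) (hg' : Continuous g')
    (hφ : ∀ x, HasDerivAt φ (φ₁ x) x) (hφ₁ : ∀ x, HasDerivAt φ₁ (φ₂ x) x) (hφ₂ : Continuous φ₂)
    (hε : 0 < ε) (hεR : ε ≤ R) (ht : 0 < t) (hm : 0 < m)
    (hlow : ∀ x ∈ Set.Icc ε R, m * x ≤ |φ₁ x|) (hM₂ : ∀ x ∈ Set.Icc ε R, |φ₂ x| ≤ M)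
    (hM₀ : ∀ x ∈ Set.Icc ε R, ‖g x‖ ≤ M) (hM₁ : ∀ x ∈ Set.Icc ε R, ‖g' x‖ ≤ M / x) :
    ‖∫ x in ε..R, g x * cexp (I * (t * φ x : ℝ))‖
      ≤ 3 * (M / m + M ^ 2 / m ^ 2) / (t * ε) := by
  have hM : 0 ≤ M := (norm_nonneg _).trans (hM₀ ε ⟨le_rfl, hεR⟩)
  set K := M / m + M ^ 2 / m ^ 2 with hK
  have hK0 : 0 ≤ K := by positivity
  have hpos : ∀ x ∈ Set.Icc ε R, 0 < x := fun x hx => hε.trans_le hx.1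
  have hne : ∀ x ∈ Set.Icc ε R, φ₁ x ≠ 0 := fun x hx =>
    abs_pos.1 ((mul_pos hm (hpos x hx)).trans_le (hlow x hx))
  have hneC : ∀ x ∈ Set.Icc ε R, (φ₁ x : ℂ) ≠ 0 := fun x hx => by exact_mod_cast hne x hx
  have hR : 0 < R := hε.trans_le hεR
  have hcg : Continuous g := continuous_iff_continuousAt.2 fun x => (hg x).continuousAt
  have hcφ : Continuous φ := continuous_iff_continuousAt.2 fun x => (hφ x).continuousAt
  have hcφ₁ : Continuous φ₁ := continuous_iff_continuousAt.2 fun x => (hφ₁ x).continuousAt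
  set u : ℝ → ℂ := fun x => g x / φ₁ x
  set u' : ℝ → ℂ := fun x => (g' x * φ₁ x - g x * φ₂ x) / (φ₁ x : ℂ) ^ 2
  set v : ℝ → ℂ := fun x => cexp (I * (t * φ x : ℝ)) / (I * t)
  set v' : ℝ → ℂ := fun x => φ₁ x * cexp (I * (t * φ x : ℝ))
  have htC : (t : ℂ) ≠ 0 := by exact_mod_cast ht.ne'
  have hu : ∀ x ∈ Set.Icc ε R, HasDerivAt u (u' x) x := fun x hx =>
    (hg x).div (hφ₁ x).ofReal_comp (hneC x hx)
  have hv : ∀ x, HasDerivAt v (v' x) x := by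
    intro x
    have h := ((((hφ x).const_mul t).ofReal_comp.const_mul I).cexp).div_const (I * t)
    refine h.congr_deriv ?_
    simp only [v']
    push_cast
    field_simp
  have hcu' : ContinuousOn u' (Set.Icc ε R) := by
    apply ContinuousOn.div
    · fun_prop
    · fun_prop
    · intro x hx; exact pow_ne_zero _ (hneC x hx)
  have hcv' : Continuous v' := by fun_prop
  have hnv : ∀ x, ‖v x‖ = 1 / t := by
    intro x
    simp only [v, norm_div, Complex.norm_exp_I_mul_ofReal, norm_mul, norm_I, one_mul,
      Complex.norm_real, Real.norm_eq_abs, abs_of_pos ht]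
  have hnu : ∀ x ∈ Set.Icc ε R, ‖u x‖ ≤ M / m / x := by
    intro x hx
    have := hpos x hx
    simp only [u, norm_div, Complex.norm_real, Real.norm_eq_abs, div_div]
    exact div_le_div₀ hM (hM₀ x hx) (by positivity) (hlow x hx)
  have hnu' : ∀ x ∈ Set.Icc ε R, ‖u' x‖ ≤ K * x ^ (-2 : ℤ) := by
    intro x hx
    have hx0 := hpos x hx
    have e : u' x = g' x / φ₁ x - g x * φ₂ x / (φ₁ x : ℂ) ^ 2 := by
      have := hneC x hx
      simp only [u']
      field_simp
    rw [e]
    refine (norm_sub_le _ _).trans ?_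
    have h1 : ‖g' x / (φ₁ x : ℂ)‖ ≤ M / x / (m * x) := by
      simp only [norm_div, Complex.norm_real, Real.norm_eq_abs]
      exact div_le_div₀ (by positivity) (hM₁ x hx) (by positivity) (hlow x hx)
    have h2 : ‖g x * φ₂ x / (φ₁ x : ℂ) ^ 2‖ ≤ M * M / (m * x) ^ 2 := by
      simp only [norm_div, norm_mul, norm_pow, Complex.norm_real, Real.norm_eq_abs]
      exact div_le_div₀ (by positivity)
        (mul_le_mul (hM₀ x hx) (hM₂ x hx) (abs_nonneg _) hM) (by positivity)
        (pow_le_pow_left₀ (by positivity) (hlow x hx) 2)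
    refine (add_le_add h1 h2).trans (le_of_eq ?_)
    rw [hK, zpow_neg]
    field_simp
  have hibp : ∫ x in ε..R, u x * v' x = u R * v R - u ε * v ε - ∫ x in ε..R, u' x * v x := by
    apply intervalIntegral.integral_mul_deriv_eq_deriv_mul
    · intro x hx; rw [Set.uIcc_of_le hεR] at hx; exact hu x hx
    · intro x _; exact hv x
    · apply ContinuousOn.intervalIntegrable; rwa [Set.uIcc_of_le hεR]
    · exact hcv'.intervalIntegrable _ _
  have hcongr : ∫ x in ε..R, g x * cexp (I * (t * φ x : ℝ)) = ∫ x in ε..R, u x * v' x := by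
    apply intervalIntegral.integral_congr
    intro x hx
    rw [Set.uIcc_of_le hεR] at hx
    have := hneC x hx
    simp only [u, v']
    field_simp
  have hint : ‖∫ x in ε..R, u' x * v x‖ ≤ K / t / ε := by
    have h0 : (0 : ℝ) ∉ Set.uIcc ε R := by
      rw [Set.uIcc_of_le hεR]; intro h; exact absurd h.1 (not_le.2 hε)
    have h1 : ‖∫ x in ε..R, u' x * v x‖ ≤ ∫ x in ε..R, K / t * x ^ (-2 : ℤ) := by
      apply intervalIntegral.norm_integral_le_of_norm_le hεR
      · refine Eventually.of_forall fun x hx => ?_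
        rw [norm_mul, hnv]
        have := hnu' x ⟨hx.1.le, hx.2⟩
        calc _ ≤ K * x ^ (-2 : ℤ) * (1 / t) := by gcongr
          _ = _ := by ring
      · exact (intervalIntegral.intervalIntegrable_zpow (Or.inr h0)).const_mul _
    refine h1.trans ?_
    rw [intervalIntegral.integral_const_mul, integral_zpow (Or.inr ⟨by norm_num, h0⟩)]
    have : (R ^ (-2 + 1 : ℤ) - ε ^ (-2 + 1 : ℤ)) / (((-2 : ℤ) : ℝ) + 1) = 1 / ε - 1 / R := by
      norm_num [zpow_neg]
      ring
    rw [this, div_eq_mul_one_div (K / t) ε]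
    have : 0 < 1 / R := by positivity
    gcongr
    linarith
  rw [hcongr, hibp]
  have hMK : M / m ≤ K := by rw [hK]; linarith [show 0 ≤ M ^ 2 / m ^ 2 by positivity]
  have hbR : ‖u R * v R‖ ≤ K / t / ε := by
    rw [norm_mul, hnv]
    calc _ ≤ M / m / R * (1 / t) := by gcongr; exact hnu R ⟨hεR, le_rfl⟩
      _ ≤ K / ε * (1 / t) := by gcongr
      _ = _ := by ring
  have hbε : ‖u ε * v ε‖ ≤ K / t / ε := by
    rw [norm_mul, hnv]
    calc _ ≤ M / m / ε * (1 / t) := by gcongr; exact hnu ε ⟨le_rfl, hεR⟩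
      _ ≤ K / ε * (1 / t) := by gcongr
      _ = _ := by ring
  calc _ ≤ ‖u R * v R‖ + ‖u ε * v ε‖ + ‖∫ x in ε..R, u' x * v x‖ :=
        (norm_sub_le _ _).trans (add_le_add_left (norm_sub_le _ _) _)
    _ ≤ K / t / ε + K / t / ε + K / t / ε := by gcongr
    _ = _ := by field_simp; ring

theorem exp_neg_sq_mul_sq_le (x : ℝ) : x ^ 2 * Real.exp (-x ^ 2) ≤ 1 / 2 := by
  have h := Real.two_mul_le_exp (x := x ^ 2)
  rw [Real.exp_neg, ← div_eq_mul_inv, div_le_iff₀ (Real.exp_pos _)]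
  linarith

theorem norm_integral_gaussian_tail_le {A ε t : ℝ} (hA : A ≠ 0) (hε : 0 < ε) (ht : 0 < t) :
    ‖(∫ x in Set.Ioi (0 : ℝ), cexp (-(1 - I * (t * A)) * (x : ℂ) ^ 2)) -
      ∫ x in (0 : ℝ)..ε, cexp (-(1 - I * (t * A)) * (x : ℂ) ^ 2)‖
      ≤ 3 * ((1 + 2 * |A|) / (2 * |A|) + (1 + 2 * |A|) ^ 2 / (2 * |A|) ^ 2) / (t * ε) := by
  have hA' : 0 < |A| := abs_pos.2 hA
  set f : ℝ → ℂ := fun x => cexp (-(1 - I * (t * A)) * (x : ℂ) ^ 2) with hf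
  have hcf : Continuous f := by fun_prop
  have hre : 0 < (1 - I * (t * A) : ℂ).re := by simp
  have hi : Integrable f := integrable_cexp_neg_mul_sq hre
  have hlim := intervalIntegral_tendsto_integral_Ioi 0 hi.integrableOn
    (tendsto_id (α := ℝ) (x := atTop))
  refine le_of_tendsto ((hlim.sub_const (∫ x in (0 : ℝ)..ε, f x)).norm) ?_
  filter_upwards [eventually_ge_atTop ε] with R hR
  rw [intervalIntegral.integral_interval_sub_left (hcf.intervalIntegrable _ _)
    (hcf.intervalIntegrable _ _)]
  have key := norm_integral_mul_exp_phase_le (g := fun x => ((Real.exp (-x ^ 2) : ℝ) : ℂ))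
    (g' := fun x => ((Real.exp (-x ^ 2) * (-(2 * x)) : ℝ) : ℂ))
    (φ := fun x => A * x ^ 2) (φ₁ := fun x => A * (2 * x)) (φ₂ := fun _ => A * 2)
    (ε := ε) (R := R) (t := t) (m := 2 * |A|) (M := 1 + 2 * |A|)
    ?_ (by fun_prop) ?_ ?_ continuous_const hε hR ht (by positivity) ?_ ?_ ?_ ?_
  · refine le_trans (le_of_eq ?_) key
    congr 1
    apply intervalIntegral.integral_congr
    intro x _
    simp only [hf]
    push_cast
    rw [← Complex.exp_add]
    ring_nf
  · intro x
    have := ((hasDerivAt_pow 2 x).neg.exp).ofReal_comp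
    simpa using this
  · intro x
    simpa using (hasDerivAt_pow 2 x).const_mul A
  · intro x
    simpa using ((hasDerivAt_id x).const_mul 2).const_mul A
  · intro x hx
    have : 0 < x := hε.trans_le hx.1
    rw [abs_mul, abs_of_pos (show 0 < 2 * x by positivity)]
    linarith
  · intro x _
    rw [abs_mul]; norm_num; linarith
  · intro x hx
    rw [Complex.norm_real, Real.norm_eq_abs, abs_of_pos (Real.exp_pos _)]
    have : Real.exp (-x ^ 2) ≤ 1 := Real.exp_le_one_iff.2 (by nlinarith [sq_nonneg x])
    linarith
  · intro x hx
    have h0 : 0 < x := hε.trans_le hx.1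
    rw [Complex.norm_real, Real.norm_eq_abs, abs_mul, abs_of_pos (Real.exp_pos _), abs_neg,
      abs_of_pos (show 0 < 2 * x by positivity), le_div_iff₀ h0]
    have := exp_neg_sq_mul_sq_le x
    nlinarith

theorem sqrt_mul_cpow_half {t : ℝ} (ht : 0 < t) {z : ℂ} (hz : z ≠ 0) :
    (√t : ℂ) * z ^ (1 / 2 : ℂ) = (t * z) ^ (1 / 2 : ℂ) := by
  have htC : (t : ℂ) ≠ 0 := by exact_mod_cast ht.ne'
  have h : (√t : ℂ) = (t : ℂ) ^ (1 / 2 : ℂ) := by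
    rw [Real.sqrt_eq_rpow, Complex.ofReal_cpow ht.le]
    norm_num
  rw [h, cpow_def_of_ne_zero hz, cpow_def_of_ne_zero htC, cpow_def_of_ne_zero (mul_ne_zero htC hz),
    Complex.log_ofReal_mul ht hz, ← Complex.exp_add, Complex.ofReal_log ht.le]
  ring_nf

theorem tendsto_sqrt_mul_gaussian {A : ℝ} (hA : A ≠ 0) :
    Tendsto (fun t : ℝ => (√t : ℂ) *
      ∫ x in Set.Ioi (0 : ℝ), cexp (-(1 - I * (t * A)) * (x : ℂ) ^ 2)) atTop
      (nhds ((π * I / A) ^ (1 / 2 : ℂ) / 2)) := by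
  have hAC : (A : ℂ) ≠ 0 := by exact_mod_cast hA
  have hπ : (π : ℂ) ≠ 0 := by exact_mod_cast Real.pi_ne_zero
  have hlim : Tendsto (fun t : ℝ => (π : ℂ) / ((t⁻¹ : ℝ) - I * A)) atTop
      (nhds (π / ((0 : ℝ) - I * A))) := by
    refine Tendsto.div tendsto_const_nhds ?_ ?_
    · exact ((continuous_ofReal.tendsto _).comp tendsto_inv_atTop_zero).sub_const _
    · simp [hA]
  have e : (π : ℂ) / ((0 : ℝ) - I * A) = π * I / A := by
    have := I_ne_zero
    simp only [ofReal_zero, zero_sub]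
    field_simp
    simp
  rw [e] at hlim
  have hslit : (π * I / A : ℂ) ∈ slitPlane := by
    right
    have : (π * I / A : ℂ) = ((π / A : ℝ) : ℂ) * I := by push_cast; ring
    rw [this]
    simpa using hA
  refine (((continuousAt_cpow_const hslit).tendsto.comp hlim).div_const 2).congr' ?_
  filter_upwards [eventually_gt_atTop 0] with t ht
  have htC : (t : ℂ) ≠ 0 := by exact_mod_cast ht.ne'
  simp only [Function.comp_apply]
  have hre : 0 < (1 - I * (t * A) : ℂ).re := by simp
  have hne : (1 - I * (t * A) : ℂ) ≠ 0 := fun h => by rw [h] at hre; simp at hre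
  rw [integral_gaussian_complex_Ioi hre, ← mul_div_assoc,
    sqrt_mul_cpow_half ht (div_ne_zero hπ hne)]
  congr 2
  have : ((t⁻¹ : ℝ) : ℂ) - I * A = (1 - I * (t * A)) / t := by
    push_cast; field_simp
  rw [this]
  field_simp

theorem exists_mul_le_abs_of_simple_zero {f f' : ℝ → ℝ} {b : ℝ} (hb : 0 < b)
    (hf : ∀ x, HasDerivAt f (f' x) x) (h0 : f 0 = 0) (h1 : f' 0 ≠ 0)
    (hne : ∀ x ∈ Set.Ioc 0 b, f x ≠ 0) :
    ∃ m > 0, ∀ x ∈ Set.Icc 0 b, m * x ≤ |f x| := by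
  have hc : Continuous (dslope f 0) := by
    rw [← continuousOn_univ, continuousOn_dslope univ_mem]
    exact ⟨fun x _ => (hf x).continuousAt.continuousWithinAt, (hf 0).differentiableAt⟩
  obtain ⟨y, hy, hmin⟩ := isCompact_Icc.exists_isMinOn (Set.nonempty_Icc.2 hb.le)
    (hc.norm.continuousOn (s := Set.Icc 0 b))
  have hval : ∀ x, f x = x * dslope f 0 x := by
    intro x
    have := sub_smul_dslope f 0 x
    simpa [h0] using this.symm
  refine ⟨‖dslope f 0 y‖, norm_pos_iff.2 ?_, ?_⟩
  · rcases hy.1.eq_or_lt with h | h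
    · rw [← h, dslope_same, (hf 0).deriv]; exact h1
    · intro h'
      exact hne y ⟨h, hy.2⟩ (by rw [hval, h', mul_zero])
  · intro x hx
    rw [hval x, abs_mul, abs_of_nonneg hx.1, mul_comm]
    exact mul_le_mul_of_nonneg_left (hmin hx) hx.1

theorem exists_norm_sub_le_mul {g : ℝ → ℂ} (hg : ContDiff ℝ 1 g) {b : ℝ} (hb : 0 < b) :
    ∃ C, ∀ x ∈ Set.Icc 0 b, ‖g x - g 0‖ ≤ C * x := by
  obtain ⟨C, hC⟩ := exists_taylor_mean_remainder_bound (n := 0) hb.le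
    (f := g) (by simpa using hg.contDiffOn)
  exact ⟨C, fun x hx => by simpa using hC x hx⟩

theorem exists_abs_sub_quadratic_le {φ φ₁ φ₂ : ℝ → ℝ} (hφC : ContDiff ℝ 3 φ)
    (hφ : ∀ x, HasDerivAt φ (φ₁ x) x) (hφ₁ : ∀ x, HasDerivAt φ₁ (φ₂ x) x) (h0 : φ₁ 0 = 0)
    {b : ℝ} (hb : 0 < b) :
    ∃ C, ∀ x ∈ Set.Icc 0 b, |φ x - φ 0 - φ₂ 0 / 2 * x ^ 2| ≤ C * x ^ 3 := by
  obtain ⟨C, hC⟩ := exists_taylor_mean_remainder_bound (n := 2) hb.le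
    (f := φ) (hφC.contDiffOn.of_le (by norm_num))
  have hd1 : deriv φ = φ₁ := funext fun x => (hφ x).deriv
  have hd2 : deriv φ₁ = φ₂ := funext fun x => (hφ₁ x).deriv
  have hmem : (0 : ℝ) ∈ Set.Icc 0 b := ⟨le_rfl, hb.le⟩
  have e1 : iteratedDerivWithin 1 φ (Set.Icc 0 b) 0 = φ₁ 0 := by
    rw [iteratedDerivWithin_eq_iteratedDeriv (uniqueDiffOn_Icc hb)
      (hφC.contDiffAt.of_le (by norm_num)) hmem, iteratedDeriv_one, hd1]
  have e2 : iteratedDerivWithin 2 φ (Set.Icc 0 b) 0 = φ₂ 0 := by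
    rw [iteratedDerivWithin_eq_iteratedDeriv (uniqueDiffOn_Icc hb)
      (hφC.contDiffAt.of_le (by norm_num)) hmem, iteratedDeriv_succ, iteratedDeriv_one, hd1, hd2]
  refine ⟨C, fun x hx => ?_⟩
  have := hC x hx
  rw [taylorWithinEval_succ, taylorWithinEval_succ, taylor_within_zero_eval] at this
  norm_num [e1, e2, h0] at this
  convert this using 2
  ring

/-- The error of the Gaussian model for a critical point at the left end of the interval, with a
free cut-off `ε`. -/
theorem exists_norm_integral_sub_gaussian_le {g : ℝ → ℂ} {φ φ₁ φ₂ : ℝ → ℝ} {b : ℝ}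
    (hg : ContDiff ℝ 1 g) (hφC : ContDiff ℝ 3 φ)
    (hφ : ∀ x, HasDerivAt φ (φ₁ x) x) (hφ₁ : ∀ x, HasDerivAt φ₁ (φ₂ x) x) (hφ₂ : Continuous φ₂)
    (hb : 0 < b) (h0 : φ₁ 0 = 0) (h2 : φ₂ 0 ≠ 0) (hne : ∀ x ∈ Set.Ioc 0 b, φ₁ x ≠ 0) :
    ∃ C, ∀ ε t : ℝ, 0 < ε → ε ≤ b → ε ≤ 1 → 0 < t →
      ‖(∫ x in (0 : ℝ)..b, g x * cexp (I * (t * φ x : ℝ))) -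
        g 0 * cexp (I * (t * φ 0 : ℝ)) *
          ∫ x in Set.Ioi (0 : ℝ), cexp (-(1 - I * (t * (φ₂ 0 / 2 : ℝ))) * (x : ℂ) ^ 2)‖
        ≤ C * (ε ^ 2 + t * ε ^ 4 + 1 / (t * ε)) := by
  obtain ⟨m, hm, hlow⟩ := exists_mul_le_abs_of_simple_zero hb hφ₁ h0 h2 hne
  obtain ⟨Cg, hCg⟩ := exists_norm_sub_le_mul hg hb
  obtain ⟨Cφ, hCφ⟩ := exists_abs_sub_quadratic_le hφC hφ hφ₁ h0 hb
  have hgd : ∀ x, HasDerivAt g (deriv g x) x := fun x =>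
    (hg.differentiable (by norm_num) x).hasDerivAt
  have hcg' : Continuous (deriv g) := hg.continuous_deriv (by norm_num)
  obtain ⟨M₀, hM₀⟩ := isCompact_Icc.exists_bound_of_continuousOn (s := Set.Icc 0 b)
    hg.continuous.continuousOn
  obtain ⟨M₁, hM₁⟩ := isCompact_Icc.exists_bound_of_continuousOn (s := Set.Icc 0 b)
    hcg'.continuousOn
  obtain ⟨M₂, hM₂⟩ := isCompact_Icc.exists_bound_of_continuousOn (s := Set.Icc 0 b)
    hφ₂.continuousOn
  have hmem : (0 : ℝ) ∈ Set.Icc 0 b := ⟨le_rfl, hb.le⟩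
  have hM₀0 : 0 ≤ M₀ := (norm_nonneg _).trans (hM₀ 0 hmem)
  have hM₁0 : 0 ≤ M₁ := (norm_nonneg _).trans (hM₁ 0 hmem)
  have hM₂0 : 0 ≤ M₂ := (norm_nonneg _).trans (hM₂ 0 hmem)
  set A := φ₂ 0 / 2
  have hA : A ≠ 0 := div_ne_zero h2 two_ne_zero
  set M := M₀ + M₁ * b + M₂
  set K₁ := 3 * (M / m + M ^ 2 / m ^ 2)
  set K₂ := 3 * ((1 + 2 * |A|) / (2 * |A|) + (1 + 2 * |A|) ^ 2 / (2 * |A|) ^ 2)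
  have hK₁ : 0 ≤ K₁ := by positivity
  have hK₂ : 0 ≤ K₂ := by positivity
  set C := |Cg| + M₀ + M₀ * |Cφ| + K₁ + M₀ * K₂
  refine ⟨C, fun ε t hε hεb hε1 ht => ?_⟩
  set E := cexp (I * (t * φ 0 : ℝ))
  have hE : ‖E‖ = 1 := Complex.norm_exp_I_mul_ofReal _
  set f : ℝ → ℂ := fun x => g x * cexp (I * (t * φ x : ℝ))
  set h : ℝ → ℂ := fun x => cexp (-(1 - I * (t * (A : ℝ))) * (x : ℂ) ^ 2)
  have hcφ : Continuous φ := hφC.continuous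
  have hcg : Continuous g := hg.continuous
  have hcf : Continuous f := by fun_prop
  have hch : Continuous h := by fun_prop
  have htail : ‖∫ x in ε..b, f x‖ ≤ K₁ / (t * ε) := by
    have sub : ∀ x ∈ Set.Icc ε b, x ∈ Set.Icc 0 b := fun x hx => ⟨hε.le.trans hx.1, hx.2⟩
    have hM₁b : 0 ≤ M₁ * b := by positivity
    refine norm_integral_mul_exp_phase_le hgd hcg' hφ hφ₁ hφ₂ hε hεb ht hm
      (fun x hx => hlow x (sub x hx)) (fun x hx => ?_) (fun x hx => ?_) (fun x hx => ?_)
    · have := hM₂ x (sub x hx)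
      rw [Real.norm_eq_abs] at this
      simp only [M]; linarith
    · have := hM₀ x (sub x hx)
      simp only [M]; linarith
    · have hx0 : 0 < x := hε.trans_le hx.1
      have h1 := hM₁ x (sub x hx)
      rw [le_div_iff₀ hx0]
      have : ‖deriv g x‖ * x ≤ M₁ * b := mul_le_mul h1 hx.2 hx0.le hM₁0
      simp only [M]; linarith
  have hgtail := norm_integral_gaussian_tail_le hA hε ht
  have hpt : ∀ x ∈ Set.Icc 0 ε, ‖f x - g 0 * E * h x‖ ≤
      |Cg| * ε + M₀ * (t * (|Cφ| * ε ^ 3) + ε ^ 2) := by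
    intro x hx
    have hxb : x ∈ Set.Icc 0 b := ⟨hx.1, hx.2.trans hεb⟩
    set r := φ x - φ 0 - A * x ^ 2
    have hfac : f x - g 0 * E * h x = (g x - g 0) * cexp (I * (t * φ x : ℝ)) +
        g 0 * (E * cexp (I * (t * (A * x ^ 2) : ℝ)) *
          ((cexp (I * (t * r : ℝ)) - 1) + (1 - (Real.exp (-x ^ 2) : ℝ)))) := by
      have e1 : cexp (I * (t * φ x : ℝ)) =
          E * cexp (I * (t * (A * x ^ 2) : ℝ)) * cexp (I * (t * r : ℝ)) := by
        simp only [E, ← Complex.exp_add, r]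
        congr 1; push_cast; ring
      have e2 : h x = cexp (I * (t * (A * x ^ 2) : ℝ)) * (Real.exp (-x ^ 2) : ℝ) := by
        simp only [h, Complex.ofReal_exp, ← Complex.exp_add]
        congr 1; push_cast; ring
      simp only [f]
      rw [e2, e1]; ring
    have n1 : ‖cexp (I * (t * r : ℝ)) - 1‖ ≤ t * (|Cφ| * ε ^ 3) := by
      refine Real.norm_exp_I_mul_ofReal_sub_one_le.trans ?_
      rw [Real.norm_eq_abs, abs_mul, abs_of_pos ht]
      gcongr
      calc |r| ≤ Cφ * x ^ 3 := hCφ x hxb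
        _ ≤ |Cφ| * ε ^ 3 := by
          have := hx.1
          exact mul_le_mul (le_abs_self _) (pow_le_pow_left₀ hx.1 hx.2 3) (by positivity)
            (abs_nonneg _)
    have n2 : ‖(1 - (Real.exp (-x ^ 2) : ℝ) : ℂ)‖ ≤ ε ^ 2 := by
      rw [← Complex.ofReal_one, ← Complex.ofReal_sub, Complex.norm_real, Real.norm_eq_abs,
        abs_of_nonneg]
      · have := Real.one_sub_le_exp_neg (x ^ 2)
        have := pow_le_pow_left₀ hx.1 hx.2 2
        linarith
      · have : Real.exp (-x ^ 2) ≤ 1 := Real.exp_le_one_iff.2 (by nlinarith [sq_nonneg x])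
        linarith
    have n3 : ‖g x - g 0‖ ≤ |Cg| * ε := (hCg x hxb).trans
      (mul_le_mul (le_abs_self _) hx.2 hx.1 (abs_nonneg _))
    rw [hfac]
    refine (norm_add_le _ _).trans ?_
    rw [norm_mul, norm_mul, norm_mul, norm_mul, hE, Complex.norm_exp_I_mul_ofReal,
      Complex.norm_exp_I_mul_ofReal, mul_one, mul_one, one_mul]
    gcongr
    · exact hM₀ 0 hmem
    · exact (norm_add_le _ _).trans (add_le_add n1 n2)
  have hin : ‖∫ x in (0 : ℝ)..ε, (f x - g 0 * E * h x)‖ ≤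
      (|Cg| * ε + M₀ * (t * (|Cφ| * ε ^ 3) + ε ^ 2)) * ε := by
    have := intervalIntegral.norm_integral_le_of_norm_le_const (a := 0) (b := ε)
      (f := fun x => f x - g 0 * E * h x) (fun x hx => hpt x (by
        rw [Set.uIoc_of_le hε.le] at hx; exact ⟨hx.1.le, hx.2⟩))
    rwa [sub_zero, abs_of_pos hε] at this
  have hsplit : (∫ x in (0 : ℝ)..b, f x) - g 0 * E * ∫ x in Set.Ioi (0 : ℝ), h x =
      (∫ x in (0 : ℝ)..ε, (f x - g 0 * E * h x)) + (∫ x in ε..b, f x) -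
        g 0 * E * ((∫ x in Set.Ioi (0 : ℝ), h x) - ∫ x in (0 : ℝ)..ε, h x) := by
    have hch' : Continuous fun x => g 0 * E * h x := continuous_const.mul hch
    rw [intervalIntegral.integral_sub (hcf.intervalIntegrable _ _)
      (hch'.intervalIntegrable _ _), intervalIntegral.integral_const_mul,
      ← intervalIntegral.integral_add_adjacent_intervals (hcf.intervalIntegrable 0 ε)
        (hcf.intervalIntegrable ε b)]
    ring
  rw [hsplit]
  have hlast : ‖g 0 * E * ((∫ x in Set.Ioi (0 : ℝ), h x) - ∫ x in (0 : ℝ)..ε, h x)‖ ≤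
      M₀ * (K₂ / (t * ε)) := by
    rw [norm_mul, norm_mul, hE, mul_one]
    exact mul_le_mul (hM₀ 0 hmem) hgtail (norm_nonneg _) hM₀0
  calc _ ≤ (|Cg| * ε + M₀ * (t * (|Cφ| * ε ^ 3) + ε ^ 2)) * ε + K₁ / (t * ε)
        + M₀ * (K₂ / (t * ε)) :=
      (norm_sub_le _ _).trans (add_le_add ((norm_add_le _ _).trans (add_le_add hin htail)) hlast)
    _ = |Cg| * ε ^ 2 + M₀ * |Cφ| * (t * ε ^ 4) + M₀ * (ε ^ 2 * ε) + K₁ * (1 / (t * ε))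
        + M₀ * K₂ * (1 / (t * ε)) := by ring
    _ ≤ |Cg| * ε ^ 2 + M₀ * |Cφ| * (t * ε ^ 4) + M₀ * (ε ^ 2 * 1) + K₁ * (1 / (t * ε))
        + M₀ * K₂ * (1 / (t * ε)) := by gcongr
    _ ≤ C * (ε ^ 2 + t * ε ^ 4 + 1 / (t * ε)) := by
      have a1 : 0 ≤ ε ^ 2 := by positivity
      have a2 : 0 ≤ t * ε ^ 4 := by positivity
      have a3 : 0 ≤ 1 / (t * ε) := by positivity
      have c1 : |Cg| + M₀ ≤ C := by
        simp only [C]; linarith [show 0 ≤ M₀ * |Cφ| by positivity, show 0 ≤ M₀ * K₂ by positivity]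
      have c2 : M₀ * |Cφ| ≤ C := by
        simp only [C]; linarith [abs_nonneg Cg, show 0 ≤ M₀ * K₂ by positivity]
      have c3 : K₁ + M₀ * K₂ ≤ C := by
        simp only [C]; linarith [abs_nonneg Cg, show 0 ≤ M₀ * |Cφ| by positivity]
      have := mul_le_mul_of_nonneg_right c1 a1
      have := mul_le_mul_of_nonneg_right c2 a2
      have := mul_le_mul_of_nonneg_right c3 a3
      linarith

/-- Stationary phase for a critical point at the left end of the interval. -/
theorem tendsto_stationary_phase_left_end {g : ℝ → ℂ} {φ φ₁ φ₂ : ℝ → ℝ} {b : ℝ}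
    (hg : ContDiff ℝ 1 g) (hφC : ContDiff ℝ 3 φ)
    (hφ : ∀ x, HasDerivAt φ (φ₁ x) x) (hφ₁ : ∀ x, HasDerivAt φ₁ (φ₂ x) x) (hφ₂ : Continuous φ₂)
    (hb : 0 < b) (h0 : φ₁ 0 = 0) (h2 : φ₂ 0 ≠ 0) (hne : ∀ x ∈ Set.Ioc 0 b, φ₁ x ≠ 0) :
    Tendsto (fun t : ℝ => (√t : ℂ) * (∫ x in (0 : ℝ)..b, g x * cexp (I * (t * φ x : ℝ))) -
      g 0 * cexp (I * (t * φ 0 : ℝ)) * ((π * I / (φ₂ 0 / 2 : ℝ)) ^ (1 / 2 : ℂ) / 2))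
      atTop (nhds 0) := by
  obtain ⟨C, hC⟩ := exists_norm_integral_sub_gaussian_le hg hφC hφ hφ₁ hφ₂ hb h0 h2 hne
  set A := φ₂ 0 / 2
  have hA : A ≠ 0 := div_ne_zero h2 two_ne_zero
  set G : ℝ → ℂ := fun t => ∫ x in Set.Ioi (0 : ℝ), cexp (-(1 - I * (t * A)) * (x : ℂ) ^ 2)
  set L : ℂ := (π * I / A) ^ (1 / 2 : ℂ) / 2
  have hG : Tendsto (fun t : ℝ => (√t : ℂ) * G t) atTop (nhds L) := tendsto_sqrt_mul_gaussian hA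
  have hmain : Tendsto (fun t : ℝ => (√t : ℂ) *
      ((∫ x in (0 : ℝ)..b, g x * cexp (I * (t * φ x : ℝ))) -
        g 0 * cexp (I * (t * φ 0 : ℝ)) * G t)) atTop (nhds 0) := by
    have hlim : Tendsto (fun t : ℝ => C * (t ^ (-(3 / 10) : ℝ) + t ^ (-(1 / 10) : ℝ) +
        t ^ (-(1 / 10) : ℝ))) atTop (nhds 0) := by
      have h3 := tendsto_rpow_neg_atTop (show (0 : ℝ) < 3 / 10 by norm_num)
      have h1 := tendsto_rpow_neg_atTop (show (0 : ℝ) < 1 / 10 by norm_num)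
      simpa using ((h3.add h1).add h1).const_mul C
    refine squeeze_zero_norm' ?_ hlim
    have hε := tendsto_rpow_neg_atTop (show (0 : ℝ) < 2 / 5 by norm_num)
    filter_upwards [eventually_gt_atTop 0, hε.eventually_le_const hb,
      hε.eventually_le_const one_pos] with t ht h1 h2
    have hb := hC _ t (Real.rpow_pos_of_pos ht _) h1 h2 ht
    rw [norm_mul, Complex.norm_real, Real.norm_eq_abs, abs_of_nonneg (Real.sqrt_nonneg _)]
    refine (mul_le_mul_of_nonneg_left hb (Real.sqrt_nonneg _)).trans (le_of_eq ?_)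
    have e1 : √t * (t ^ (-(2 / 5) : ℝ)) ^ 2 = t ^ (-(3 / 10) : ℝ) := by
      rw [Real.sqrt_eq_rpow, ← Real.rpow_natCast, ← Real.rpow_mul ht.le, ← Real.rpow_add ht]
      norm_num
    have e2 : √t * (t * (t ^ (-(2 / 5) : ℝ)) ^ 4) = t ^ (-(1 / 10) : ℝ) := by
      nth_rewrite 2 [← Real.rpow_one t]
      rw [Real.sqrt_eq_rpow, ← Real.rpow_natCast, ← Real.rpow_mul ht.le, ← Real.rpow_add ht,
        ← Real.rpow_add ht]
      norm_num
    have e3 : √t * (1 / (t * t ^ (-(2 / 5) : ℝ))) = t ^ (-(1 / 10) : ℝ) := by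
      nth_rewrite 2 [← Real.rpow_one t]
      rw [Real.sqrt_eq_rpow, ← Real.rpow_add ht, one_div (t ^ _), ← Real.rpow_neg ht.le,
        ← Real.rpow_add ht]
      norm_num
    rw [← e1]
    nth_rewrite 1 [← e2]
    rw [← e3]
    ring
  have hsecond : Tendsto (fun t : ℝ => g 0 * cexp (I * (t * φ 0 : ℝ)) * ((√t : ℂ) * G t - L))
      atTop (nhds 0) := by
    have hz : Tendsto (fun t : ℝ => ‖g 0‖ * ‖(√t : ℂ) * G t - L‖) atTop (nhds 0) := by
      simpa using ((hG.sub_const L).norm).const_mul ‖g 0‖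
    refine squeeze_zero_norm (fun t => le_of_eq ?_) hz
    rw [norm_mul, norm_mul, Complex.norm_exp_I_mul_ofReal, mul_one]
  have := hmain.add hsecond
  rw [add_zero] at this
  refine this.congr fun t => ?_
  ring

/-- Stationary phase for a single nondegenerate interior critical point. -/
theorem tendsto_stationary_phase {g : ℝ → ℂ} {φ φ₁ φ₂ : ℝ → ℝ} {a x₀ b : ℝ}
    (hg : ContDiff ℝ 1 g) (hφC : ContDiff ℝ 3 φ)
    (hφ : ∀ x, HasDerivAt φ (φ₁ x) x) (hφ₁ : ∀ x, HasDerivAt φ₁ (φ₂ x) x) (hφ₂ : Continuous φ₂)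
    (ha : a < x₀) (hb : x₀ < b) (h0 : φ₁ x₀ = 0) (h2 : φ₂ x₀ ≠ 0)
    (hne : ∀ x ∈ Set.Icc a b, φ₁ x = 0 → x = x₀) :
    Tendsto (fun t : ℝ => (√t : ℂ) * (∫ x in a..b, g x * cexp (I * (t * φ x : ℝ))) -
      g x₀ * cexp (I * (t * φ x₀ : ℝ)) * (π * I / (φ₂ x₀ / 2 : ℝ)) ^ (1 / 2 : ℂ))
      atTop (nhds 0) := by
  have hright := tendsto_stationary_phase_left_end (g := fun x => g (x₀ + x))
    (φ := fun x => φ (x₀ + x)) (φ₁ := fun x => φ₁ (x₀ + x)) (φ₂ := fun x => φ₂ (x₀ + x))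
    (b := b - x₀) (by fun_prop) (by fun_prop) (fun x => (hφ _).comp_const_add x₀ x)
    (fun x => (hφ₁ _).comp_const_add x₀ x) (by fun_prop) (by linarith) (by simpa using h0)
    (by simpa using h2) (fun x hx h => by
      have := hne (x₀ + x) ⟨by linarith [hx.1], by linarith [hx.2]⟩ h
      linarith [hx.1])
  have hleft := tendsto_stationary_phase_left_end (g := fun x => g (x₀ - x))
    (φ := fun x => φ (x₀ - x)) (φ₁ := fun x => -φ₁ (x₀ - x)) (φ₂ := fun x => φ₂ (x₀ - x))
    (b := x₀ - a) (by fun_prop) (by fun_prop) (fun x => (hφ _).comp_const_sub x₀ x)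
    (fun x => ((hφ₁ _).comp_const_sub x₀ x).fun_neg.congr_deriv (neg_neg _)) (by fun_prop) (by linarith)
    (by simpa using h0) (by simpa using h2) (fun x hx h => by
      have := hne (x₀ - x) ⟨by linarith [hx.2], by linarith [hx.1]⟩ (neg_eq_zero.1 h)
      linarith [hx.1])
  have hsum := hleft.add hright
  rw [add_zero (0 : ℂ)] at hsum
  refine hsum.congr fun t => ?_
  set f : ℝ → ℂ := fun x => g x * cexp (I * (t * φ x : ℝ)) with hf
  have hcφ : Continuous φ := hφC.continuous
  have hcg : Continuous g := hg.continuous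
  have hcf : Continuous f := by fun_prop
  have e1 : ∫ x in (0 : ℝ)..(b - x₀), g (x₀ + x) * cexp (I * (t * φ (x₀ + x) : ℝ)) =
      ∫ x in x₀..b, f x := by
    have := intervalIntegral.integral_comp_add_left (a := 0) (b := b - x₀) f x₀
    simpa [hf] using this
  have e2 : ∫ x in (0 : ℝ)..(x₀ - a), g (x₀ - x) * cexp (I * (t * φ (x₀ - x) : ℝ)) =
      ∫ x in a..x₀, f x := by
    have := intervalIntegral.integral_comp_sub_left (a := 0) (b := x₀ - a) f x₀
    simpa [hf] using this
  rw [e1, e2, ← intervalIntegral.integral_add_adjacent_intervals (hcf.intervalIntegrable a x₀)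
    (hcf.intervalIntegrable x₀ b)]
  simp only [sub_zero, add_zero]
  ring

theorem cpow_half_pi_mul_I_div {s D : ℝ} (hs : s = 1 ∨ s = -1) (hD : 0 < D) :
    (π * I / (s * D / 2 : ℝ)) ^ (1 / 2 : ℂ) = (√(2 * π / D) : ℂ) * cexp (I * (s * (π / 4) : ℝ)) := by
  have hDC : (D : ℂ) ≠ 0 := by exact_mod_cast hD.ne'
  have hpos : 0 < 2 * π / D := by positivity
  have e : (π * I / (s * D / 2 : ℝ) : ℂ) = (2 * π / D : ℝ) * (s * I) := by
    rcases hs with rfl | rfl <;> push_cast <;> field_simp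
  have hlog : Complex.log (s * I) = I * (s * (π / 2) : ℝ) := by
    rcases hs with rfl | rfl
    · simp [Complex.log_I, mul_comm]
    · simp [Complex.log_neg_I, mul_comm]
  have hne : (s * I : ℂ) ≠ 0 := by
    rcases hs with rfl | rfl <;> simp
  rw [e, ← sqrt_mul_cpow_half hpos hne, cpow_def_of_ne_zero hne, hlog]
  congr 2
  push_cast
  ring

/-- Stationary phase along the integers, in both directions. -/
theorem tendsto_int_stationary_phase {g : ℝ → ℂ} {φ φ₁ φ₂ : ℝ → ℝ} {a x₀ b s D : ℝ}
    (hg : ContDiff ℝ 1 g) (hφC : ContDiff ℝ 3 φ)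
    (hφ : ∀ x, HasDerivAt φ (φ₁ x) x) (hφ₁ : ∀ x, HasDerivAt φ₁ (φ₂ x) x) (hφ₂ : Continuous φ₂)
    (ha : a < x₀) (hb : x₀ < b) (h0 : φ₁ x₀ = 0) (hs : s = 1 ∨ s = -1) (hD : 0 < D)
    (h2 : φ₂ x₀ = s * D) (hne : ∀ x ∈ Set.Icc a b, φ₁ x = 0 → x = x₀) :
    Tendsto (fun k : ℤ => (√|(k : ℝ)| : ℂ) * (∫ x in a..b, g x * cexp (I * (k * φ x : ℝ))) -
      g x₀ * cexp (I * (k * φ x₀ + s * (π / 4) * (k.sign : ℝ) : ℝ)) * (√(2 * π / D) : ℂ))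
      cofinite (nhds 0) := by
  have hs0 : s ≠ 0 := by rcases hs with rfl | rfl <;> norm_num
  rw [Int.cofinite_eq, tendsto_sup]
  constructor
  · have key := tendsto_stationary_phase (φ := fun x => -φ x) (φ₁ := fun x => -φ₁ x)
      (φ₂ := fun x => -φ₂ x) hg hφC.neg (fun x => (hφ x).neg) (fun x => (hφ₁ x).neg) hφ₂.neg
      ha hb (by simpa using h0) (by simpa [h2] using ⟨hs0, hD.ne'⟩)
      (fun x hx h => hne x hx (neg_eq_zero.1 h))
    have hk : Tendsto (fun k : ℤ => ((-k : ℤ) : ℝ)) atBot atTop :=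
      tendsto_intCast_atTop_atTop.comp tendsto_neg_atBot_atTop
    refine (key.comp hk).congr' ?_
    filter_upwards [eventually_lt_atBot 0] with k hk0
    have hkR : (k : ℝ) < 0 := by exact_mod_cast hk0
    have hs' : -s = 1 ∨ -s = -1 := by rcases hs with rfl | rfl <;> simp
    have e := cpow_half_pi_mul_I_div hs' hD
    rw [neg_mul, ← h2] at e
    simp only [Function.comp_apply]
    rw [e, abs_of_neg hkR, Int.sign_eq_neg_one_of_neg hk0]
    push_cast
    simp only [neg_mul_neg]
    rw [mul_comm (√(2 * π / D) : ℂ), ← mul_assoc, mul_assoc (g x₀), ← Complex.exp_add]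
    ring_nf
  · have key := tendsto_stationary_phase hg hφC hφ hφ₁ hφ₂ ha hb h0
      (by rw [h2]; exact mul_ne_zero hs0 hD.ne') hne
    refine (key.comp (tendsto_intCast_atTop_atTop (R := ℝ))).congr' ?_
    filter_upwards [eventually_gt_atTop 0] with k hk0
    have hkR : (0 : ℝ) < k := by exact_mod_cast hk0
    have e := cpow_half_pi_mul_I_div hs hD
    rw [← h2] at e
    simp only [Function.comp_apply]
    rw [e, abs_of_pos hkR, Int.sign_eq_one_of_pos hk0]
    push_cast
    rw [mul_comm (√(2 * π / D) : ℂ), ← mul_assoc, mul_assoc (g x₀), ← Complex.exp_add]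
    ring_nf

/-- `tendsto_int_stationary_phase` for a periodic amplitude, with the critical point translated by
`2π` and the normalisation of Fourier coefficients. -/
theorem tendsto_int_stationary_phase_periodic {g : ℝ → ℂ} {φ φ₁ φ₂ : ℝ → ℝ} {a b μ y s D : ℝ}
    (hg : ContDiff ℝ 1 g) (hgper : Function.Periodic g (2 * π)) (hφC : ContDiff ℝ 3 φ)
    (hφ : ∀ x, HasDerivAt φ (φ₁ x) x) (hφ₁ : ∀ x, HasDerivAt φ₁ (φ₂ x) x) (hφ₂ : Continuous φ₂)
    (ha : a < μ + 2 * π) (hb : μ + 2 * π < b) (hy : φ (μ + 2 * π) = y + 2 * π)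
    (h0 : φ₁ (μ + 2 * π) = 0) (hs : s = 1 ∨ s = -1) (hD : 0 < D)
    (h2 : φ₂ (μ + 2 * π) = s * D) (hne : ∀ x ∈ Set.Icc a b, φ₁ x = 0 → x = μ + 2 * π) :
    Tendsto (fun k : ℤ => (√|(k : ℝ)| : ℂ) *
        (1 / (2 * (π : ℂ)) * ∫ x in a..b, g x * cexp (I * (k : ℂ) * (φ x : ℂ))) -
      (√(1 / (2 * π * D)) : ℂ) * g μ * cexp (I * (k * y + s * (π / 4) * (k.sign : ℝ) : ℝ)))
      cofinite (nhds 0) := by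
  have key := (tendsto_int_stationary_phase hg hφC hφ hφ₁ hφ₂ ha hb h0 hs hD h2 hne).const_mul
    (1 / (2 * (π : ℂ)))
  rw [mul_zero] at key
  refine key.congr fun k => ?_
  have hc : (√(1 / (2 * π * D)) : ℂ) = 1 / (2 * (π : ℂ)) * (√(2 * π / D) : ℂ) := by
    have : √(1 / (2 * π * D)) = 1 / (2 * π) * √(2 * π / D) := by
      rw [← Real.sqrt_sq (show 0 ≤ 1 / (2 * π) by positivity), ← Real.sqrt_mul (by positivity)]
      congr 1
      field_simp
    rw [this]; push_cast; rfl
  have hexp : cexp (I * (k * φ (μ + 2 * π) + s * (π / 4) * (k.sign : ℝ) : ℝ)) =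
      cexp (I * (k * y + s * (π / 4) * (k.sign : ℝ) : ℝ)) := by
    rw [hy, ← mul_one (cexp (I * (k * y + _ : ℝ))), ← Complex.exp_int_mul_two_pi_mul_I k,
      ← Complex.exp_add]
    congr 1; push_cast; ring
  have hint : ∫ x in a..b, g x * cexp (I * (k * φ x : ℝ)) =
      ∫ x in a..b, g x * cexp (I * (k : ℂ) * (φ x : ℂ)) := by
    congr 1; ext x; push_cast; rw [mul_assoc]
  rw [hc, hexp, hint, hgper μ]
  ring

theorem eq_two_pi_sub_arccos {x c : ℝ} (hx : x ∈ Set.Icc 0 (2 * π)) (hs : Real.sin x < 0)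
    (hc : Real.cos x = c) : x = -Real.arccos c + 2 * π := by
  have hπ : π < x := by
    by_contra h
    exact absurd (Real.sin_nonneg_of_nonneg_of_le_pi hx.1 (not_lt.1 h)) (not_le.2 hs)
  have : Real.arccos (Real.cos (2 * π - x)) = 2 * π - x :=
    Real.arccos_cos (by linarith [hx.2]) (by linarith)
  rw [Real.cos_two_pi_sub, hc] at this
  linarith

theorem cos_neg_arccos_add {c : ℝ} (h₁ : -1 < c) (h₂ : c < 1) :
    Real.cos (-Real.arccos c + 2 * π) = c := by
  rw [Real.cos_add_two_pi, Real.cos_neg, Real.cos_arccos h₁.le h₂.le]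

theorem sin_neg_arccos_add_neg {c : ℝ} (h₁ : -1 < c) (h₂ : c < 1) :
    Real.sin (-Real.arccos c + 2 * π) < 0 := by
  rw [Real.sin_add_two_pi, Real.sin_neg, Real.sin_arccos, neg_lt_zero]
  exact Real.sqrt_pos.2 (by nlinarith)

/-- The critical points of `λ + β ω(λ)`. -/
theorem one_add_mul_div_eq_zero_iff {ω₀ ω₁ β w s c : ℝ} (hω₁ : 0 < ω₁) (hβ : 0 < β) (hw : 0 < w)
    (hw2 : w ^ 2 = ω₀ ^ 2 + 2 * ω₁ ^ 2 * (1 - c)) (hsc : s ^ 2 + c ^ 2 = 1) :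
    1 + β * (ω₁ ^ 2 * s / w) = 0 ↔
      s < 0 ∧ (β ^ 2 * ω₁ ^ 2 * c - 1) ^ 2 = (β ^ 2 * ω₁ ^ 2 - 1) ^ 2 - β ^ 2 * ω₀ ^ 2 := by
  have e : 1 + β * (ω₁ ^ 2 * s / w) = 0 ↔ w = -(β * ω₁ ^ 2 * s) := by
    constructor
    · intro h; field_simp at h; linarith
    · intro h; field_simp; linarith
  have hβω : 0 < β * ω₁ ^ 2 := by positivity
  rw [e]
  constructor
  · intro h
    have hs : s < 0 := by nlinarith
    refine ⟨hs, ?_⟩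
    have h2 : (β * ω₁ ^ 2 * s) ^ 2 = ω₀ ^ 2 + 2 * ω₁ ^ 2 * (1 - c) := by rw [← hw2, h]; ring
    linear_combination (-β ^ 2) * h2 + β ^ 4 * ω₁ ^ 4 * hsc
  · rintro ⟨hs, h⟩
    have h2 : β ^ 2 * (w ^ 2 - (-(β * ω₁ ^ 2 * s)) ^ 2) = 0 := by
      linear_combination β ^ 2 * hw2 + h - β ^ 4 * ω₁ ^ 4 * hsc
    have h3 : w ^ 2 = (-(β * ω₁ ^ 2 * s)) ^ 2 := by
      have := (mul_eq_zero.1 h2).resolve_left (by positivity)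
      linarith
    exact (pow_left_inj₀ hw.le (by nlinarith) two_ne_zero).1 h3

/-- Contribution of one of the two critical points `σ = ±1` when the spectrum is gapped. -/
theorem tendsto_critical_point_of_gap {ω₀ ω₁ β Δ σ a b c c' : ℝ} {ω : ℝ → ℝ} {g : ℝ → ℂ}
    (hω₀ : 0 < ω₀) (hω₁ : 0 < ω₁) (hβ : 0 < β)
    (hω : ∀ l : ℝ, ω l = √(ω₀ ^ 2 + 2 * ω₁ ^ 2 * (1 - Real.cos l)))
    (hg : ContDiff ℝ 1 g) (hgper : Function.Periodic g (2 * π)) (hΔ : 0 < Δ)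
    (hΔ2 : Δ ^ 2 = (β ^ 2 * ω₁ ^ 2 - 1) ^ 2 - β ^ 2 * ω₀ ^ 2) (hσ : σ = 1 ∨ σ = -1)
    (hc : c = (1 + σ * Δ) / (β ^ 2 * ω₁ ^ 2)) (hc' : c' = (1 - σ * Δ) / (β ^ 2 * ω₁ ^ 2))
    (hc₁ : -1 < c) (hc₂ : c < 1) (ha : 0 ≤ a) (hb : b ≤ 2 * π)
    (haμ : a < -Real.arccos c + 2 * π) (hbμ : -Real.arccos c + 2 * π < b)
    (hother : -Real.arccos c' + 2 * π ∉ Set.Icc a b) :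
    Tendsto (fun k : ℤ => (√|(k : ℝ)| : ℂ) * (1 / (2 * (π : ℂ)) *
        ∫ x in a..b, g x * cexp (I * (k : ℂ) * ((x + β * ω x : ℝ) : ℂ))) -
      (√(β * ω (-Real.arccos c) / (2 * π * Δ)) : ℂ) * g (-Real.arccos c) *
        cexp (I * (k * (-Real.arccos c + β * ω (-Real.arccos c)) +
          σ * (π / 4) * (k.sign : ℝ) : ℝ)))
      cofinite (nhds 0) := by
  set μ := -Real.arccos c
  have hB : 0 < β ^ 2 * ω₁ ^ 2 := by positivity
  have hW : ∀ l, 0 < ω₀ ^ 2 + 2 * ω₁ ^ 2 * (1 - Real.cos l) := fun l => by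
    have : 0 ≤ 1 - Real.cos l := by linarith [Real.cos_le_one l]
    positivity
  have hωpos : ∀ l, 0 < ω l := fun l => by rw [hω]; exact Real.sqrt_pos.2 (hW l)
  have hω2 : ∀ l, ω l ^ 2 = ω₀ ^ 2 + 2 * ω₁ ^ 2 * (1 - Real.cos l) := fun l => by
    rw [hω, Real.sq_sqrt (hW l).le]
  have hωC : ContDiff ℝ 3 ω := by
    rw [show ω = _ from funext hω]
    exact ContDiff.sqrt (by fun_prop) fun l => (hW l).ne'
  have hωd : ∀ l, HasDerivAt ω (ω₁ ^ 2 * Real.sin l / ω l) l := fun l => by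
    have h := (((Real.hasDerivAt_cos l).const_sub 1).const_mul (2 * ω₁ ^ 2)).const_add (ω₀ ^ 2)
    have h' := h.sqrt (hW l).ne'
    rw [← hω l, ← show ω = _ from funext hω] at h'
    refine h'.congr_deriv ?_
    have := (hωpos l).ne'
    field_simp
  set φ₁ : ℝ → ℝ := fun x => 1 + β * (ω₁ ^ 2 * Real.sin x / ω x)
  set φ₂ : ℝ → ℝ := fun x => β * ((ω₁ ^ 2 * Real.cos x * ω x -
    ω₁ ^ 2 * Real.sin x * (ω₁ ^ 2 * Real.sin x / ω x)) / ω x ^ 2)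
  have hφ : ∀ x, HasDerivAt (fun x => x + β * ω x) (φ₁ x) x := fun x =>
    (hasDerivAt_id x).add ((hωd x).const_mul β)
  have hφ₁ : ∀ x, HasDerivAt φ₁ (φ₂ x) x := fun x =>
    ((((Real.hasDerivAt_sin x).const_mul (ω₁ ^ 2)).div (hωd x) (hωpos x).ne').const_mul
      β).const_add 1
  have hcω : Continuous ω := hωC.continuous
  have hφ₂ : Continuous φ₂ := by
    have h : ∀ x, ω x ≠ 0 := fun x => (hωpos x).ne'
    have h' : ∀ x, ω x ^ 2 ≠ 0 := fun x => pow_ne_zero _ (h x)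
    fun_prop (disch := assumption)
  have hcrit : ∀ x, φ₁ x = 0 ↔ Real.sin x < 0 ∧ (β ^ 2 * ω₁ ^ 2 * Real.cos x - 1) ^ 2 = Δ ^ 2 :=
    fun x => by
      rw [hΔ2]
      exact one_add_mul_div_eq_zero_iff hω₁ hβ (hωpos x) (hω2 x) (Real.sin_sq_add_cos_sq x)
  have hcosμ : Real.cos (μ + 2 * π) = c := cos_neg_arccos_add hc₁ hc₂
  have hBc : β ^ 2 * ω₁ ^ 2 * c - 1 = σ * Δ := by rw [hc]; field_simp; ring
  have hσ2 : σ ^ 2 = 1 := by rcases hσ with rfl | rfl <;> norm_num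
  have h0 : φ₁ (μ + 2 * π) = 0 :=
    (hcrit _).2 ⟨sin_neg_arccos_add_neg hc₁ hc₂, by rw [hcosμ, hBc, mul_pow, hσ2, one_mul]⟩
  have hper : ω (μ + 2 * π) = ω μ := by rw [hω, hω, Real.cos_add_two_pi]
  have hD : 0 < Δ / (β * ω μ) := by have := hωpos μ; positivity
  have h2 : φ₂ (μ + 2 * π) = σ * (Δ / (β * ω μ)) := by
    have hw := (hωpos μ).ne'
    have hsin : ω₁ ^ 2 * Real.sin (μ + 2 * π) / ω μ = -1 / β := by
      have : 1 + β * (ω₁ ^ 2 * Real.sin (μ + 2 * π) / ω (μ + 2 * π)) = 0 := h0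
      rw [hper] at this
      rw [eq_div_iff hβ.ne']
      linarith
    have hsin' : ω₁ ^ 2 * Real.sin (μ + 2 * π) = -1 / β * ω μ := (div_eq_iff hw).1 hsin
    simp only [φ₂]
    rw [hper, hsin, hsin', hcosμ]
    field_simp
    linear_combination hBc
  have hne : ∀ x ∈ Set.Icc a b, φ₁ x = 0 → x = μ + 2 * π := by
    intro x hx h
    obtain ⟨hs, hsq⟩ := (hcrit x).1 h
    have hx' : x ∈ Set.Icc 0 (2 * π) := ⟨ha.trans hx.1, hx.2.trans hb⟩
    have hsq' : (β ^ 2 * ω₁ ^ 2 * Real.cos x - 1) ^ 2 = (σ * Δ) ^ 2 := by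
      rw [hsq, mul_pow, hσ2, one_mul]
    rcases sq_eq_sq_iff_eq_or_eq_neg.1 hsq' with h | h
    · exact eq_two_pi_sub_arccos hx' hs (by rw [hc]; field_simp; linarith)
    · have := eq_two_pi_sub_arccos (c := c') hx' hs (by rw [hc']; field_simp; linarith)
      exact absurd (this ▸ hx) hother
  have key := tendsto_int_stationary_phase_periodic (y := μ + β * ω μ) hg hgper
    (φ := fun x => x + β * ω x) (by fun_prop) hφ hφ₁ hφ₂ haμ hbμ (by simp only [hper]; ring)
    h0 hσ hD h2 hne
  have hcoef : 1 / (2 * π * (Δ / (β * ω μ))) = β * ω μ / (2 * π * Δ) := by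
    have := (hωpos μ).ne'
    field_simp
  rwa [hcoef] at key

/-- Contribution of the critical point in the gapless case, where `ω l = 2 ω₁ |sin (l / 2)|`. -/
theorem tendsto_critical_point_of_gapless {ω₁ β c : ℝ} {ω : ℝ → ℝ} {g : ℝ → ℂ}
    (hω₁ : 0 < ω₁) (hβ : 0 < β) (hω : ∀ l : ℝ, ω l = √(2 * ω₁ ^ 2 * (1 - Real.cos l)))
    (hB1 : 1 < β ^ 2 * ω₁ ^ 2) (hg : ContDiff ℝ 1 g) (hgper : Function.Periodic g (2 * π))
    (hc : c = (1 - (β ^ 2 * ω₁ ^ 2 - 1)) / (β ^ 2 * ω₁ ^ 2)) :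
    Tendsto (fun k : ℤ => (√|(k : ℝ)| : ℂ) * (1 / (2 * (π : ℂ)) *
        ∫ x in (0 : ℝ)..(2 * π), g x * cexp (I * (k : ℂ) * ((x + β * ω x : ℝ) : ℂ))) -
      (√(β * ω (-Real.arccos c) / (2 * π * (β ^ 2 * ω₁ ^ 2 - 1))) : ℂ) * g (-Real.arccos c) *
        cexp (I * (k * (-Real.arccos c + β * ω (-Real.arccos c)) +
          -1 * (π / 4) * (k.sign : ℝ) : ℝ)))
      cofinite (nhds 0) := by
  set μ := -Real.arccos c
  set B := β ^ 2 * ω₁ ^ 2 with hBdef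
  have hB : 0 < B := by linarith
  have hBc : B * c = 2 - B := by rw [hc]; field_simp; ring
  have hc₁ : -1 < c := by rw [hc, lt_div_iff₀ hB]; linarith
  have hc₂ : c < 1 := by rw [hc, div_lt_iff₀ hB]; linarith
  have hμ₀ : 0 < μ + 2 * π := by linarith [Real.arccos_le_pi c, Real.pi_pos]
  have hμ₁ : μ + 2 * π < 2 * π := by linarith [Real.arccos_pos.2 hc₂]
  have hcosμ : Real.cos (μ + 2 * π) = c := cos_neg_arccos_add hc₁ hc₂
  have hsinμ : Real.sin (μ + 2 * π) < 0 := sin_neg_arccos_add_neg hc₁ hc₂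
  have hdouble : ∀ x, Real.cos x = 2 * Real.cos (x / 2) ^ 2 - 1 := fun x => by
    rw [← Real.cos_two_mul, mul_div_cancel₀ _ two_ne_zero]
  have hdouble' : ∀ x, Real.sin x = 2 * Real.sin (x / 2) * Real.cos (x / 2) := fun x => by
    rw [← Real.sin_two_mul, mul_div_cancel₀ _ two_ne_zero]
  have hhalf : ∀ x ∈ Set.Icc 0 (2 * π), 0 ≤ Real.sin (x / 2) := fun x hx =>
    Real.sin_nonneg_of_nonneg_of_le_pi (by linarith [hx.1]) (by linarith [hx.2])
  have hωsin : ∀ x ∈ Set.Icc 0 (2 * π), ω x = 2 * ω₁ * Real.sin (x / 2) := by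
    intro x hx
    have := hhalf x hx
    rw [hω, hdouble, ← Real.sqrt_sq (show 0 ≤ 2 * ω₁ * Real.sin (x / 2) by positivity)]
    congr 1
    linear_combination (-4 * ω₁ ^ 2) * Real.sin_sq_add_cos_sq (x / 2)
  set S := Real.sin ((μ + 2 * π) / 2)
  set K := Real.cos ((μ + 2 * π) / 2)
  have hSK : S ^ 2 + K ^ 2 = 1 := Real.sin_sq_add_cos_sq _
  have hmem : μ + 2 * π ∈ Set.Icc 0 (2 * π) := ⟨hμ₀.le, hμ₁.le⟩
  have hS : 0 < S := Real.sin_pos_of_pos_of_lt_pi (by linarith) (by linarith)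
  have hK : K < 0 := by
    rw [hdouble'] at hsinμ
    have : 0 < 2 * S := by linarith
    exact neg_of_mul_neg_right hsinμ this.le
  have hK2 : B * K ^ 2 = 1 := by
    have : 2 * K ^ 2 - 1 = c := by rw [← hcosμ, hdouble]
    rw [← this] at hBc
    linarith
  have hβω : 0 < β * ω₁ := by positivity
  have hKval : β * ω₁ * K = -1 := by
    have : (β * ω₁ * K) ^ 2 = 1 := by rw [← hK2, hBdef]; ring
    rcases sq_eq_sq_iff_eq_or_eq_neg.1 (this.trans (one_pow 2).symm) with h | h
    · nlinarith
    · exact h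
  have hper : ω (μ + 2 * π) = ω μ := by rw [hω, hω, Real.cos_add_two_pi]
  have hωμ : ω μ = 2 * ω₁ * S := by rw [← hper, hωsin _ hmem]
  have hωpos : 0 < ω μ := by rw [hωμ]; positivity
  have hD : 0 < (B - 1) / (β * ω μ) := div_pos (by linarith) (by positivity)
  set φ : ℝ → ℝ := fun x => x + β * (2 * ω₁ * Real.sin (x / 2))
  have hφ : ∀ x, HasDerivAt φ (1 + β * ω₁ * Real.cos (x / 2)) x := fun x => by
    refine ((hasDerivAt_id x).add
      ((((hasDerivAt_id x).div_const 2).sin.const_mul (2 * ω₁)).const_mul β)).congr_deriv ?_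
    simp only [id]; ring
  have hφ₁ : ∀ x, HasDerivAt (fun x => 1 + β * ω₁ * Real.cos (x / 2))
      (-(β * ω₁ / 2 * Real.sin (x / 2))) x := fun x => by
    refine ((((hasDerivAt_id x).div_const 2).cos.const_mul (β * ω₁)).const_add 1).congr_deriv ?_
    simp only [id]; ring
  have hne : ∀ x ∈ Set.Icc 0 (2 * π), 1 + β * ω₁ * Real.cos (x / 2) = 0 → x = μ + 2 * π := by
    intro x hx h
    have hcos : Real.cos (x / 2) = K :=
      mul_left_cancel₀ hβω.ne' (by linarith)
    have hcosx : Real.cos x = c := by rw [hdouble, hcos, ← hcosμ, hdouble (μ + 2 * π)]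
    have hsin : Real.sin (x / 2) = S := by
      refine (pow_left_inj₀ (hhalf x hx) hS.le two_ne_zero).1 ?_
      have := Real.sin_sq_add_cos_sq (x / 2)
      rw [hcos] at this
      linarith
    refine eq_two_pi_sub_arccos hx ?_ hcosx
    rw [hdouble', hcos, hsin]
    nlinarith
  have key := tendsto_int_stationary_phase_periodic (φ := φ) (y := μ + β * ω μ)
    (s := -1) (D := (B - 1) / (β * ω μ)) hg hgper (by fun_prop) hφ hφ₁ (by fun_prop) hμ₀ hμ₁
    (by simp only [φ]; rw [hωμ]; ring) (by change 1 + β * ω₁ * K = 0; linarith) (Or.inr rfl) hD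
    (by
      rw [hωμ]
      field_simp
      have : β ^ 2 * ω₁ ^ 2 * S ^ 2 = B - 1 := by rw [← hBdef]; linear_combination B * hSK - hK2
      linarith) hne
  have hcoef : 1 / (2 * π * ((B - 1) / (β * ω μ))) = β * ω μ / (2 * π * (B - 1)) := by
    have : B - 1 ≠ 0 := by linarith
    field_simp
  rw [hcoef] at key
  refine key.congr fun k => ?_
  congr 3
  apply intervalIntegral.integral_congr
  intro x hx
  rw [Set.uIcc_of_le (by positivity)] at hx
  simp only [φ, hωsin x hx]

/-- Stationary-phase asymptotics of `F[g](β,k)` when `γ(β) > 0`: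
`√|k|·F[g](β,k)` approaches the two-critical-point leading term as `|k| → ∞`. -/
theorem stationary_phase_F_pos (ω₀ ω₁ β : ℝ) (hω₀ : 0 ≤ ω₀) (hω₁ : 0 < ω₁) (hβ : 0 < β)
    (ω : ℝ → ℝ) (hω : ∀ l : ℝ, ω l = Real.sqrt (ω₀ ^ 2 + 2 * ω₁ ^ 2 * (1 - Real.cos l)))
    (hγ : 0 < β ^ 2 * ω₁ ^ 2 - 1 - β * ω₀)
    (g : ℝ → ℂ) (hg : ContDiff ℝ 2 g) (hgper : Function.Periodic g (2 * π))
    (Δ : ℝ) (hΔ : Δ = Real.sqrt ((β ^ 2 * ω₁ ^ 2 - 1) ^ 2 - β ^ 2 * ω₀ ^ 2))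
    (μp μm : ℝ) (hμp : μp = -Real.arccos ((1 + Δ) / (β ^ 2 * ω₁ ^ 2)))
    (hμm : μm = -Real.arccos ((1 - Δ) / (β ^ 2 * ω₁ ^ 2)))
    (cp cm : ℝ) (hcp : cp = Real.sqrt (β * ω μp / (2 * π * Δ)))
    (hcm : cm = Real.sqrt (β * ω μm / (2 * π * Δ)))
    (ωp ωm : ℤ → ℝ)
    (hωp : ∀ k : ℤ, ωp k = (k : ℝ) * (μp + β * ω μp) + (π / 4) * (k.sign : ℝ))
    (hωm : ∀ k : ℤ, ωm k = (k : ℝ) * (μm + β * ω μm) - (π / 4) * (k.sign : ℝ))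
    (F : ℤ → ℂ)
    (hF : ∀ k : ℤ, F k =
      (1 / (2 * (π : ℂ))) * ∫ l in (0:ℝ)..(2 * π),
        g l * Complex.exp (Complex.I * (k : ℂ) * ((l + β * ω l : ℝ) : ℂ))) :
    Tendsto (fun k : ℤ =>
        (Real.sqrt |(k : ℝ)| : ℂ) * F k -
          ((cp : ℂ) * g μp * Complex.exp (Complex.I * (ωp k : ℂ)) +
            (cm : ℂ) * g μm * Complex.exp (Complex.I * (ωm k : ℂ))))
      cofinite (nhds 0) := by
  have hg1 : ContDiff ℝ 1 g := hg.of_le (by norm_num)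
  have hβω₀ : 0 ≤ β * ω₀ := by positivity
  set B := β ^ 2 * ω₁ ^ 2 with hBdef
  have hB : 0 < B := by positivity
  have hΔ2pos : 0 < (B - 1) ^ 2 - β ^ 2 * ω₀ ^ 2 := by nlinarith
  have hΔpos : 0 < Δ := by rw [hΔ]; exact Real.sqrt_pos.2 hΔ2pos
  have hΔ2 : Δ ^ 2 = (B - 1) ^ 2 - β ^ 2 * ω₀ ^ 2 := by rw [hΔ, Real.sq_sqrt hΔ2pos.le]
  rcases hω₀.eq_or_lt with h0 | h0
  · subst h0
    have hΔB : Δ = B - 1 := by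
      refine (pow_left_inj₀ hΔpos.le (by linarith) two_ne_zero).1 ?_
      rw [hΔ2]; ring
    have hμp0 : μp = 0 := by
      rw [hμp, hΔB, show 1 + (B - 1) = B by ring, div_self hB.ne', Real.arccos_one, neg_zero]
    have hcp0 : cp = 0 := by rw [hcp, hμp0, hω]; simp
    have key := tendsto_critical_point_of_gapless (ω := ω) (c := (1 - (B - 1)) / B) hω₁ hβ
      (fun l => by rw [hω]; congr 1; ring) (by linarith) hg1 hgper rfl
    rw [hΔB] at hμm hcm
    rw [← hBdef, ← hμm, ← hcm] at key
    refine key.congr fun k => ?_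
    rw [hF, hcp0, hωm, neg_one_mul, neg_mul, ← sub_eq_add_neg, ofReal_zero]
    ring
  · have hβω₀' : 0 < β * ω₀ := by positivity
    have hΔlt : Δ < B - 1 := by nlinarith
    set c₁ := (1 + Δ) / B
    set c₂ := (1 - Δ) / B
    have h₁l : -1 < c₁ := by rw [lt_div_iff₀ hB]; linarith
    have h₁u : c₁ < 1 := by rw [div_lt_iff₀ hB]; linarith
    have h₂l : -1 < c₂ := by rw [lt_div_iff₀ hB]; linarith
    have h₂u : c₂ < 1 := by rw [div_lt_iff₀ hB]; linarith
    have hcc : c₂ < c₁ := div_lt_div_of_pos_right (by linarith) hB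
    have harc : Real.arccos c₁ < Real.arccos c₂ :=
      Real.strictAntiOn_arccos ⟨h₂l.le, h₂u.le⟩ ⟨h₁l.le, h₁u.le⟩ hcc
    have hπ := Real.pi_pos
    have hap := Real.arccos_pos.2 h₁u
    have hal := Real.arccos_le_pi c₂
    obtain ⟨m, hm₁, hm₂⟩ := exists_between harc
    have keyp := tendsto_critical_point_of_gap (σ := 1) (a := -m + 2 * π) (b := 2 * π) (c := c₁)
      (c' := c₂) h0 hω₁ hβ hω hg1 hgper hΔpos hΔ2 (Or.inl rfl) (by rw [one_mul])
      (by rw [one_mul]) h₁l h₁u (by linarith) le_rfl (by linarith) (by linarith)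
      (fun h => by linarith [h.1])
    have keym := tendsto_critical_point_of_gap (σ := -1) (a := 0) (b := -m + 2 * π) (c := c₂)
      (c' := c₁) h0 hω₁ hβ hω hg1 hgper hΔpos hΔ2 (Or.inr rfl)
      (by rw [neg_one_mul, ← sub_eq_add_neg]) (by rw [neg_one_mul, sub_neg_eq_add]) h₂l h₂u
      le_rfl (by linarith) (by linarith) (by linarith) (fun h => by linarith [h.2])
    rw [← hμp, ← hcp] at keyp
    rw [← hμm, ← hcm] at keym
    have hsum := keym.add keyp
    rw [add_zero (0 : ℂ)] at hsum
    refine hsum.congr fun k => ?_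
    have hcω : Continuous ω := by rw [show ω = _ from funext hω]; fun_prop
    have hcg : Continuous g := hg.continuous
    have hcf : Continuous fun l => g l * cexp (I * (k : ℂ) * ((l + β * ω l : ℝ) : ℂ)) := by
      fun_prop
    rw [hF, hωp, hωm, ← intervalIntegral.integral_add_adjacent_intervals
      (hcf.intervalIntegrable 0 (-m + 2 * π)) (hcf.intervalIntegrable _ (2 * π))]
    rw [one_mul, neg_one_mul, neg_mul, ← sub_eq_add_neg]
    ring
end
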